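/- There exists a finitely generated subgroup of Diff^∞(ℝ/ℤ) that is dense in the C^∞ topology: there is a finite subset S ⊆ Diff^∞(ℝ/ℤ) such that for every h ∈ Diff^∞(ℝ/ℤ), every k ∈ ℕ and every ε > 0, there exists g in the subgroup generated by S with ‖g − h‖_{C^k} < ε. -/

import Mathlib

open Filter Topology Set

noncomputable section

/-- The circle ℝ/ℤ. -/
abbrev S1 := AddCircle (1 : ℝ)

/-- `F : ℝ → ℝ` is a lift of the circle map `f`: it is C^∞, commutes with the unit
translation, has everywhere positive derivative, and descends to `f` on ℝ/ℤ. -/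
def IsLift (f : Equiv.Perm S1) (F : ℝ → ℝ) : Prop :=
  ContDiff ℝ (⊤ : ℕ∞) F ∧ (∀ x, F (x + 1) = F x + 1) ∧ (∀ x, 0 < deriv F x) ∧
    ∀ x : ℝ, f (x : S1) = ((F x : ℝ) : S1)

/-- `f` is an orientation preserving C^∞ diffeomorphism of ℝ/ℤ. -/
def HasLift (f : Equiv.Perm S1) : Prop := ∃ F, IsLift f F

/-- max over 0 ≤ j ≤ k of sup over x of |F^(j)(x) - G^(j)(x)|. -/
noncomputable def liftDist (k : ℕ) (F G : ℝ → ℝ) : ℝ :=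
  ⨆ j : Fin (k + 1), ⨆ x : ℝ, |iteratedDeriv (j : ℕ) F x - iteratedDeriv (j : ℕ) G x|

/-- The C^k distance between two smooth circle diffeomorphisms: infimum over lifts. -/
noncomputable def distC (k : ℕ) (f g : Equiv.Perm S1) : ℝ :=
  sInf {d | ∃ F G, IsLift f F ∧ IsLift g G ∧ d = liftDist k F G}

/-- `f` is recurrent: for every k and ε > 0 there are arbitrarily large n ≥ 1 with
‖f^n − id‖_{C^k} < ε. -/
def Recurrent (f : Equiv.Perm S1) : Prop :=
  ∀ k : ℕ, ∀ ε : ℝ, 0 < ε → ∀ N : ℕ, ∃ n : ℕ, N ≤ n ∧ 1 ≤ n ∧ distC k (f ^ n) 1 < ε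

/-- The word length of `g` with respect to the generating set `S`: the least `k` such that
`g` is a product of `k` elements of `S ∪ S⁻¹`. -/
noncomputable def wordLength (S : Set (Equiv.Perm S1)) (g : Equiv.Perm S1) : ℕ :=
  sInf {k | ∃ l : List (Equiv.Perm S1),
    l.length = k ∧ (∀ x ∈ l, x ∈ S ∨ x⁻¹ ∈ S) ∧ l.prod = g}

/-- The rotation by `t` on ℝ/ℤ, `x ↦ x + t`. -/
def rot (t : S1) : Equiv.Perm S1 := Equiv.addRight t

/-- `f` is a distortion element of Diff^∞(ℝ/ℤ). -/
def IsDistortion (f : Equiv.Perm S1) : Prop :=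
  ∃ S : Finset (Equiv.Perm S1), (∀ g ∈ S, HasLift g) ∧
    f ∈ Subgroup.closure (S : Set (Equiv.Perm S1)) ∧
    Tendsto (fun n : ℕ => (wordLength (S : Set (Equiv.Perm S1)) (f ^ n) : ℝ) / n)
      atTop (nhds 0)

/-- The open arc in ℝ/ℤ which is the image of the interval `(a,b)`. -/
def arcOO (a b : ℝ) : Set S1 := (fun x : ℝ => (x : S1)) '' Set.Ioo a b

/-- The closed arc in ℝ/ℤ which is the image of the interval `[a,b]`. -/
def arcCC (a b : ℝ) : Set S1 := (fun x : ℝ => (x : S1)) '' Set.Icc a b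

/-- `f` is supported on `U`: it is the identity outside `U`. -/
def SupportedOn (f : Equiv.Perm S1) (U : Set S1) : Prop := ∀ x : S1, x ∉ U → f x = x

/-- `f` has rotation number `t ∈ ℝ/ℤ`. -/
def HasRotNum (f : Equiv.Perm S1) (t : S1) : Prop :=
  ∃ F : ℝ → ℝ, ∃ τ : ℝ, IsLift f F ∧ ((τ : ℝ) : S1) = t ∧
    Tendsto (fun n : ℕ => F^[n] 0 / n) atTop (nhds τ)

/-- A real number is Diophantine. -/
def DiophantineReal (t : ℝ) : Prop :=
  ∃ C : ℝ, 0 < C ∧ ∃ n : ℕ, 0 < n ∧ ∀ p q : ℤ, q ≠ 0 →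
    C / |(q : ℝ)| ^ n < |(q : ℝ) * t - (p : ℝ)|

/-- An element of ℝ/ℤ is Diophantine if some (equivalently, every) lift is. -/
def Diophantine (t : S1) : Prop := ∃ τ : ℝ, (τ : S1) = t ∧ DiophantineReal τ


abbrev Sm (φ : ℝ → ℝ) : Prop := ContDiff ℝ (⊤ : ℕ∞) φ

def Nk (k : ℕ) (φ : ℝ → ℝ) (c : ℝ) : Prop := ∀ j ≤ k, ∀ x, |iteratedDeriv j φ x| ≤ c

def Pk (k : ℕ) (F : ℝ → ℝ) (D : ℝ) : Prop := ∀ j < k, ∀ x, |iteratedDeriv j (deriv F) x| ≤ D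

lemma Sm.dif {φ : ℝ → ℝ} (h : Sm φ) : Differentiable ℝ φ := (contDiff_infty_iff_deriv.1 h).1

lemma Sm.der {φ : ℝ → ℝ} (h : Sm φ) : Sm (deriv φ) := (contDiff_infty_iff_deriv.1 h).2

lemma Sm.at {φ : ℝ → ℝ} (h : Sm φ) (n : ℕ) (x : ℝ) : ContDiffAt ℝ n φ x :=
  (h.of_le (by exact_mod_cast le_top)).contDiffAt

lemma Sm.iter {φ : ℝ → ℝ} (h : Sm φ) (n : ℕ) : Sm (iteratedDeriv n φ) := by
  induction n generalizing φ with
  | zero => simpa using h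
  | succ n ih => rw [iteratedDeriv_succ']; exact ih h.der

lemma Nk_zero {φ : ℝ → ℝ} {c : ℝ} : Nk 0 φ c ↔ ∀ x, |φ x| ≤ c := by
  simp [Nk]

lemma Nk_succ {k : ℕ} {φ : ℝ → ℝ} {c : ℝ} :
    Nk (k + 1) φ c ↔ (∀ x, |φ x| ≤ c) ∧ Nk k (deriv φ) c := by
  constructor
  · intro h
    refine ⟨fun x => by simpa using h 0 (by omega) x, fun j hj x => ?_⟩
    rw [← iteratedDeriv_succ']
    exact h (j + 1) (by omega) x
  · rintro ⟨h0, h⟩ j hj x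
    cases j with
    | zero => simpa using h0 x
    | succ j => rw [iteratedDeriv_succ']; exact h j (by omega) x

lemma Pk_zero (F : ℝ → ℝ) (D : ℝ) : Pk 0 F D := fun j hj => by omega

lemma Pk_succ {k : ℕ} {F : ℝ → ℝ} {D : ℝ} : Pk (k + 1) F D ↔ Nk k (deriv F) D :=
  ⟨fun h j hj x => h j (by omega) x, fun h j hj x => h j (by omega) x⟩

lemma Pk.down {k l : ℕ} {F : ℝ → ℝ} {D : ℝ} (h : Pk k F D) (hl : l ≤ k) : Pk l F D :=
  fun j hj x => h j (by omega) x

lemma Pk.mono {k : ℕ} {F : ℝ → ℝ} {D D' : ℝ} (h : Pk k F D) (hl : D ≤ D') : Pk k F D' :=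
  fun j hj x => (h j hj x).trans hl

lemma Nk.down {k l : ℕ} {F : ℝ → ℝ} {D : ℝ} (h : Nk k F D) (hl : l ≤ k) : Nk l F D :=
  fun j hj x => h j (by omega) x

lemma Nk.mono {k : ℕ} {F : ℝ → ℝ} {D D' : ℝ} (h : Nk k F D) (hl : D ≤ D') : Nk k F D' :=
  fun j hj x => (h j hj x).trans hl

lemma Nk.nonneg {k : ℕ} {F : ℝ → ℝ} {D : ℝ} (h : Nk k F D) : 0 ≤ D :=
  (abs_nonneg _).trans (h 0 (by omega) 0)

lemma Nk.bd {k : ℕ} {F : ℝ → ℝ} {D : ℝ} (h : Nk k F D) (x : ℝ) : |F x| ≤ D := by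
  simpa using h 0 (by omega) x

lemma Nk.pk {k : ℕ} {F : ℝ → ℝ} {D : ℝ} (h : Nk k F D) : Pk k F D := fun j hj x => by
  rw [← iteratedDeriv_succ']; exact h (j + 1) (by omega) x

lemma Nk.add {k : ℕ} {φ ψ : ℝ → ℝ} {a b : ℝ} (hφ : Sm φ) (hψ : Sm ψ) (h1 : Nk k φ a)
    (h2 : Nk k ψ b) : Nk k (fun x => φ x + ψ x) (a + b) := by
  intro j hj x
  rw [iteratedDeriv_fun_add (hφ.at j x) (hψ.at j x)]
  exact (abs_add_le _ _).trans (add_le_add (h1 j hj x) (h2 j hj x))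

lemma Nk.sub {k : ℕ} {φ ψ : ℝ → ℝ} {a b : ℝ} (hφ : Sm φ) (hψ : Sm ψ) (h1 : Nk k φ a)
    (h2 : Nk k ψ b) : Nk k (fun x => φ x - ψ x) (a + b) := by
  intro j hj x
  rw [iteratedDeriv_fun_sub (hφ.at j x) (hψ.at j x)]
  exact (abs_sub _ _).trans (add_le_add (h1 j hj x) (h2 j hj x))

lemma Nk.cmul {k : ℕ} {φ : ℝ → ℝ} {a : ℝ} (hφ : Sm φ) (h1 : Nk k φ a) (c : ℝ) :
    Nk k (fun x => c * φ x) (|c| * a) := by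
  intro j hj x
  rw [iteratedDeriv_const_mul c (hφ.at j x), abs_mul]
  exact mul_le_mul_of_nonneg_left (h1 j hj x) (abs_nonneg _)

lemma Nk.shift {k : ℕ} {φ : ℝ → ℝ} {a : ℝ} (h1 : Nk k φ a) (c : ℝ) :
    Nk k (fun x => φ (x + c)) a := by
  intro j hj x
  rw [iteratedDeriv_comp_add_const]
  exact h1 j hj _

lemma Nk.mul {k : ℕ} {φ ψ : ℝ → ℝ} {a b : ℝ} (hφ : Sm φ) (hψ : Sm ψ) (h1 : Nk k φ a)
    (h2 : Nk k ψ b) : Nk k (fun x => φ x * ψ x) (2 ^ k * (a * b)) := by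
  induction k generalizing φ ψ with
  | zero =>
    rw [Nk_zero]
    intro x
    rw [abs_mul]
    simpa using mul_le_mul (h1.bd x) (h2.bd x) (abs_nonneg _) h1.nonneg
  | succ k ih =>
    rw [Nk_succ]
    have hab : 0 ≤ a * b := mul_nonneg h1.nonneg h2.nonneg
    constructor
    · intro x
      rw [abs_mul]
      have := mul_le_mul (h1.bd x) (h2.bd x) (abs_nonneg _) h1.nonneg
      have h3 : (1 : ℝ) ≤ 2 ^ (k + 1) := one_le_pow₀ (by norm_num)
      nlinarith
    · have e : deriv (fun x => φ x * ψ x) = fun x => deriv φ x * ψ x + φ x * deriv ψ x := by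
        ext x
        exact deriv_fun_mul (hφ.dif x) (hψ.dif x)
      rw [e]
      have h3 := ih hφ.der hψ (Nk_succ.1 h1).2 (h2.down (by omega))
      have h4 := ih hφ hψ.der (h1.down (by omega)) (Nk_succ.1 h2).2
      exact (h3.add (hφ.der.mul hψ) (hφ.mul hψ.der) h4).mono (by rw [pow_succ]; linarith)

lemma deriv_comp_fun {φ F : ℝ → ℝ} (hφ : Sm φ) (hF : Sm F) :
    deriv (fun x => φ (F x)) = fun x => deriv φ (F x) * deriv F x := by
  ext x
  exact deriv_comp x (hφ.dif _) (hF.dif x)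

lemma Nk_comp (k : ℕ) (D : ℝ) : ∃ C : ℝ, 1 ≤ C ∧ ∀ φ F : ℝ → ℝ, ∀ a : ℝ, Sm φ → Sm F →
    Pk k F D → Nk k φ a → Nk k (fun x => φ (F x)) (C * a) := by
  induction k with
  | zero =>
    refine ⟨1, le_rfl, fun φ F a hφ hF _ h => ?_⟩
    rw [Nk_zero] at *
    intro x; simpa using h (F x)
  | succ k ih =>
    obtain ⟨C, hC, H⟩ := ih
    refine ⟨max 1 (2 ^ k * (C * D)), le_max_left _ _, fun φ F a hφ hF hP h => ?_⟩
    have ha := h.nonneg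
    rw [Nk_succ]
    constructor
    · intro x
      refine (h.bd (F x)).trans ?_
      have := le_max_left 1 (2 ^ k * (C * D))
      nlinarith
    · rw [deriv_comp_fun hφ hF]
      have h1 := H (deriv φ) F a hφ.der hF (hP.down (by omega)) (Nk_succ.1 h).2
      have h2 := h1.mul (hφ.der.comp hF) hF.der (Pk_succ.1 hP)
      refine h2.mono ?_
      have := le_max_right 1 (2 ^ k * (C * D))
      nlinarith

def AB (φ : ℝ → ℝ) : Prop := ∀ k, ∃ c, Nk k φ c

lemma AB.der {φ : ℝ → ℝ} (h : AB φ) : AB (deriv φ) := fun k => by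
  obtain ⟨c, hc⟩ := h (k + 1)
  exact ⟨c, (Nk_succ.1 hc).2⟩

lemma mvt_bd {φ : ℝ → ℝ} (hφ : Differentiable ℝ φ) {c : ℝ} (h : ∀ x, |deriv φ x| ≤ c) (x y : ℝ) :
    |φ y - φ x| ≤ c * |y - x| :=
  Convex.norm_image_sub_le_of_norm_deriv_le (𝕜 := ℝ) (s := univ) (fun x _ => hφ x)
    (fun x _ => h x) convex_univ (mem_univ _) (mem_univ _)

lemma taylor_bd {φ : ℝ → ℝ} (hφ : Sm φ) {c : ℝ} (h : ∀ x, |deriv (deriv φ) x| ≤ c) (x s : ℝ) :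
    |φ (x + s) - φ x - s * deriv φ x| ≤ c * s ^ 2 := by
  have hc : 0 ≤ c := (abs_nonneg _).trans (h 0)
  have key : ∀ y ∈ uIcc x (x + s), ‖deriv (fun y => φ y - y * deriv φ x) y‖ ≤ c * |s| := by
    intro y hy
    have : deriv (fun y => φ y - y * deriv φ x) y = deriv φ y - deriv φ x := by
      have h1 : HasDerivAt (fun y => φ y - y * deriv φ x) (deriv φ y - 1 * deriv φ x) y :=
        (hφ.dif y).hasDerivAt.sub ((hasDerivAt_id y).mul_const _)
      rw [h1.deriv]; ring
    rw [this]
    refine (mvt_bd hφ.der.dif h x y).trans ?_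
    refine mul_le_mul_of_nonneg_left ?_ hc
    have := abs_sub_left_of_mem_uIcc hy
    simpa using this
  have := Convex.norm_image_sub_le_of_norm_deriv_le (𝕜 := ℝ) (s := uIcc x (x + s))
    (f := fun y => φ y - y * deriv φ x) (x := x) (y := x + s)
    (fun y _ => (hφ.dif y).sub ((differentiableAt_id).mul_const _))
    key (convex_uIcc _ _) left_mem_uIcc right_mem_uIcc
  simp only [Real.norm_eq_abs, add_sub_cancel_left] at this
  calc _ = |φ (x + s) - (x + s) * deriv φ x - (φ x - x * deriv φ x)| := by congr 1; ring
    _ ≤ _ := this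
    _ = c * |s| ^ 2 := by ring
    _ = _ := by rw [sq_abs]

lemma Nk_lip (k : ℕ) (D : ℝ) : ∀ φ : ℝ → ℝ, Sm φ → AB (deriv φ) → ∃ C : ℝ, 0 ≤ C ∧
    ∀ F G : ℝ → ℝ, ∀ e : ℝ, Sm F → Sm G → Pk k F D → Pk k G D → Nk k (fun x => F x - G x) e →
      Nk k (fun x => φ (F x) - φ (G x)) (C * e) := by
  induction k with
  | zero =>
    intro φ hφ hb
    obtain ⟨c, hc⟩ := hb 0
    refine ⟨c, hc.nonneg, fun F G e hF hG _ _ h => ?_⟩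
    rw [Nk_zero] at *
    intro x
    exact (mvt_bd hφ.dif hc _ _).trans
      (mul_le_mul_of_nonneg_left (h x) ((abs_nonneg _).trans (hc 0)))
  | succ k ih =>
    intro φ hφ hb
    obtain ⟨C, hC, H⟩ := ih (deriv φ) hφ.der hb.der
    obtain ⟨C', hC', H'⟩ := Nk_comp k D
    obtain ⟨c, hc⟩ := hb k
    have hc0 := hc.nonneg
    refine ⟨max c (2 ^ k * (C * D + C' * c)), le_max_of_le_left hc.nonneg,
      fun F G e hF hG hPF hPG h => ?_⟩
    have he := h.nonneg
    have ed : deriv (fun x => F x - G x) = fun x => deriv F x - deriv G x := by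
      ext x; exact deriv_fun_sub (hF.dif x) (hG.dif x)
    have h' := (Nk_succ.1 h).2
    rw [ed] at h'
    rw [Nk_succ]
    constructor
    · intro x
      refine (mvt_bd hφ.dif hc.bd _ _).trans ?_
      exact mul_le_mul (le_max_left _ _) (h.bd x) (abs_nonneg _) (le_max_of_le_left hc.nonneg)
    · have e1 : deriv (fun x => φ (F x) - φ (G x)) = fun x =>
          (deriv φ (F x) - deriv φ (G x)) * deriv F x + deriv φ (G x) * (deriv F x - deriv G x) := by
        ext x
        have := deriv_fun_sub (f := fun x => φ (F x)) (g := fun x => φ (G x)) (x := x)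
          (Sm.dif (hφ.comp hF) x) (Sm.dif (hφ.comp hG) x)
        rw [this, deriv_comp_fun hφ hF, deriv_comp_fun hφ hG]
        ring
      rw [e1]
      have sF : Sm (fun x => deriv φ (F x)) := hφ.der.comp hF
      have sG : Sm (fun x => deriv φ (G x)) := hφ.der.comp hG
      have h1 := H F G e hF hG (hPF.down (by omega)) (hPG.down (by omega)) (h.down (by omega))
      have h2 := H' (deriv φ) G c hφ.der hG (hPG.down (by omega)) hc
      have h3 := h1.mul (sF.sub sG) hF.der (Pk_succ.1 hPF)
      have h4 := h2.mul sG (hF.der.sub hG.der) h'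
      refine (h3.add ((sF.sub sG).mul hF.der) (sG.mul (hF.der.sub hG.der)) h4).mono ?_
      have := mul_le_mul_of_nonneg_right (le_max_right c (2 ^ k * (C * D + C' * c))) he
      refine le_trans (le_of_eq ?_) this
      ring

structure SP (φ : ℝ → ℝ) : Prop where
  sm : Sm φ
  per : ∀ x, φ (x + 1) = φ x

lemma SP.der {φ : ℝ → ℝ} (h : SP φ) : SP (deriv φ) := by
  refine ⟨h.sm.der, fun x => ?_⟩
  rw [← deriv_comp_add_const]
  congr 1
  ext y; exact h.per y

lemma SP.bdd {φ : ℝ → ℝ} (h : SP φ) : ∃ c, ∀ x, |φ x| ≤ c := by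
  have hp : Function.Periodic φ 1 := h.per
  obtain ⟨c, hc⟩ := (hp.compact_of_continuous one_ne_zero h.sm.continuous).isBounded.exists_norm_le
  exact ⟨c, fun x => hc _ (mem_range_self x)⟩

lemma SP.ab {φ : ℝ → ℝ} (h : SP φ) : AB φ := by
  intro k
  induction k generalizing φ with
  | zero => simpa [Nk_zero] using h.bdd
  | succ k ih =>
    obtain ⟨c, hc⟩ := h.bdd
    obtain ⟨d, hd⟩ := ih h.der
    exact ⟨max c d, Nk_succ.2 ⟨fun x => (hc x).trans (le_max_left _ _), hd.mono (le_max_right _ _)⟩⟩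

structure Lf (F : ℝ → ℝ) : Prop where
  sm : Sm F
  per : ∀ x, F (x + 1) = F x + 1
  pos : ∀ x, 0 < deriv F x

lemma Lf.der {F : ℝ → ℝ} (h : Lf F) : SP (deriv F) := by
  refine ⟨h.sm.der, fun x => ?_⟩
  rw [← deriv_comp_add_const]
  have : (fun y => F (y + 1)) = fun y => F y + 1 := by ext y; exact h.per y
  rw [this, deriv_add_const]

lemma Lf.pk {F : ℝ → ℝ} (h : Lf F) (k : ℕ) : ∃ D, 0 ≤ D ∧ Pk k F D := by
  obtain ⟨c, hc⟩ := h.der.ab k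
  exact ⟨c, hc.nonneg, (Pk_succ.2 hc).down (by omega)⟩

lemma Lf.comp {F G : ℝ → ℝ} (hF : Lf F) (hG : Lf G) : Lf (fun x => F (G x)) := by
  refine ⟨hF.sm.comp hG.sm, fun x => by rw [hG.per, hF.per], fun x => ?_⟩
  rw [deriv_comp_fun hF.sm hG.sm]
  exact mul_pos (hF.pos _) (hG.pos _)

lemma sm_id : Sm (fun x => x) := contDiff_id

lemma Lf_add (c : ℝ) : Lf (fun x => x + c) := by
  refine ⟨sm_id.add contDiff_const, fun x => by ring, fun x => ?_⟩
  simp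

lemma Lf_id : Lf (fun x => x) := by simpa using Lf_add 0

lemma Pk_sub {k : ℕ} {F G : ℝ → ℝ} {D e : ℝ} (hF : Sm F) (hG : Sm G) (hP : Pk k F D)
    (h : Nk k (fun x => G x - F x) e) : Pk k G (D + e) := by
  intro j hj x
  have h1 := h.pk j hj x
  have ed : deriv (fun x => G x - F x) = fun x => deriv G x - deriv F x := by
    ext x; exact deriv_fun_sub (hG.dif x) (hF.dif x)
  rw [ed, iteratedDeriv_fun_sub (hG.der.at j x) (hF.der.at j x)] at h1
  have h2 := hP j hj x
  rw [abs_le] at *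
  constructor <;> linarith

lemma Lf.natCast {F : ℝ → ℝ} (h : Lf F) (n : ℕ) : ∀ x, F (x + n) = F x + n := by
  induction n with
  | zero => simp
  | succ n ih => intro x; push_cast; rw [← add_assoc, h.per, ih]; ring

/-- inverse of a lift -/
lemma Lf.inv {F : ℝ → ℝ} (h : Lf F) : ∃ G : ℝ → ℝ, Lf G ∧ (∀ x, F (G x) = x) ∧ ∀ x, G (F x) = x := by
  have hm : StrictMono F := strictMono_of_deriv_pos h.pos
  have hs : Function.Surjective F := by
    intro y
    obtain ⟨n, hn⟩ := exists_nat_ge (|y - F 0|)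
    rw [abs_le] at hn
    have h1 : F n = F 0 + n := by simpa using h.natCast n 0
    have h2 : F 0 = F (-n) + n := by simpa using h.natCast n (-n)
    have := mem_range_of_exists_le_of_exists_ge h.sm.continuous (c := y)
      ⟨-n, by linarith⟩ ⟨n, by linarith⟩
    exact this
  let e := (hm.orderIsoOfSurjective F hs).toHomeomorph
  have he : ∀ x, e x = F x := fun x => rfl
  have hes : Sm e.symm := e.contDiff_symm_deriv (f' := deriv F) (fun x => (h.pos x).ne')
    (fun x => (h.sm.dif x).hasDerivAt) h.sm
  have r : ∀ x, F (e.symm x) = x := fun x => e.apply_symm_apply x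
  have l : ∀ x, e.symm (F x) = x := fun x => e.symm_apply_apply x
  refine ⟨e.symm, ⟨hes, fun x => ?_, fun x => ?_⟩, r, l⟩
  · apply hm.injective
    rw [h.per, r, r]
  · have h1 : deriv (fun x => F (e.symm x)) x = 1 := by
      have : (fun x => F (e.symm x)) = fun x => x := funext r
      rw [this]; simp
    rw [deriv_comp_fun h.sm hes] at h1
    have h2 := h.pos (e.symm x)
    by_contra hneg
    push Not at hneg
    nlinarith
lemma IsLift.lf {f : Equiv.Perm S1} {F : ℝ → ℝ} (h : IsLift f F) : Lf F := ⟨h.1, h.2.1, h.2.2.1⟩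

lemma Lf.isLift {f : Equiv.Perm S1} {F : ℝ → ℝ} (h : Lf F)
    (h' : ∀ x : ℝ, f (x : S1) = ((F x : ℝ) : S1)) : IsLift f F := ⟨h.1, h.2, h.3, h'⟩

lemma IsLift.mul {f g : Equiv.Perm S1} {F G : ℝ → ℝ} (h : IsLift f F) (h' : IsLift g G) :
    IsLift (f * g) (fun x => F (G x)) :=
  (h.lf.comp h'.lf).isLift fun x => by
    rw [Equiv.Perm.mul_apply, h'.2.2.2, h.2.2.2]

lemma IsLift.inv {f : Equiv.Perm S1} {F G : ℝ → ℝ} (h : IsLift f F) (hG : Lf G)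
    (hr : ∀ x, F (G x) = x) : IsLift f⁻¹ G :=
  hG.isLift fun x => by
    rw [Equiv.Perm.inv_eq_iff_eq, h.2.2.2, hr]

lemma Lf.quot {F : ℝ → ℝ} (h : Lf F) : ∃ f : S1 → S1, ∀ x : ℝ, f (x : S1) = ((F x : ℝ) : S1) := by
  have hp : Function.Periodic (fun x : ℝ => ((F x : ℝ) : S1)) 1 := by
    intro x
    show ((F (x + 1) : ℝ) : S1) = _
    rw [h.per, AddCircle.coe_add_period]
  exact ⟨hp.lift, fun x => hp.lift_coe x⟩

lemma Lf.perm {F : ℝ → ℝ} (h : Lf F) : ∃ f : Equiv.Perm S1, IsLift f F := by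
  obtain ⟨G, hG, r, l⟩ := h.inv
  obtain ⟨f, hf⟩ := h.quot
  obtain ⟨g, hg⟩ := hG.quot
  refine ⟨⟨f, g, fun x => ?_, fun x => ?_⟩, h.isLift fun x => hf x⟩
  · induction x using QuotientAddGroup.induction_on with
    | H x =>
      show g (f (x : S1)) = (x : S1)
      rw [hf, hg, l]
  · induction x using QuotientAddGroup.induction_on with
    | H x =>
      show f (g (x : S1)) = (x : S1)
      rw [hg, hf, r]

def Gc (Γ : Subgroup (Equiv.Perm S1)) (F : ℝ → ℝ) : Prop :=
  Lf F ∧ ∀ k : ℕ, ∀ ε : ℝ, 0 < ε → ∃ g ∈ Γ, ∃ G, IsLift g G ∧ Nk k (fun x => G x - F x) ε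

lemma Nk_of_zero {k : ℕ} {φ : ℝ → ℝ} {c : ℝ} (h : ∀ x, φ x = 0) (hc : 0 ≤ c) : Nk k φ c := by
  have : φ = fun _ => 0 := funext h
  subst this
  intro j hj x
  rw [iteratedDeriv_const]
  simpa using hc

lemma Nk_const {k : ℕ} {c : ℝ} : Nk k (fun _ => c) |c| := by
  intro j hj x
  rw [iteratedDeriv_const]
  split_ifs <;> simp

lemma Gc_of_mem {Γ : Subgroup (Equiv.Perm S1)} {g : Equiv.Perm S1} {G : ℝ → ℝ} (hg : g ∈ Γ)
    (h : IsLift g G) : Gc Γ G :=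
  ⟨h.lf, fun k ε hε => ⟨g, hg, G, h, Nk_of_zero (by simp) hε.le⟩⟩

lemma Gc.closed {Γ : Subgroup (Equiv.Perm S1)} {F : ℝ → ℝ} (hF : Lf F)
    (h : ∀ k : ℕ, ∀ ε : ℝ, 0 < ε → ∃ F', Gc Γ F' ∧ Nk k (fun x => F' x - F x) ε) : Gc Γ F := by
  refine ⟨hF, fun k ε hε => ?_⟩
  obtain ⟨F', hF', h1⟩ := h k (ε / 2) (by positivity)
  obtain ⟨g, hg, G, hG, h2⟩ := hF'.2 k (ε / 2) (by positivity)
  refine ⟨g, hg, G, hG, ?_⟩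
  have := h2.add (hG.lf.sm.sub hF'.1.sm) (hF'.1.sm.sub hF.sm) h1
  simpa using this

lemma Gc.comp {Γ : Subgroup (Equiv.Perm S1)} {F₁ F₂ : ℝ → ℝ} (h₁ : Gc Γ F₁) (h₂ : Gc Γ F₂) :
    Gc Γ (fun x => F₁ (F₂ x)) := by
  refine ⟨h₁.1.comp h₂.1, fun k ε hε => ?_⟩
  obtain ⟨D, hD, hP⟩ := h₂.1.pk k
  obtain ⟨C, hC, H⟩ := Nk_comp k (D + 1)
  obtain ⟨C', hC', H'⟩ := Nk_lip k (D + 1) F₁ h₁.1.sm h₁.1.der.ab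
  obtain ⟨g₁, hg₁, G₁, hG₁, n₁⟩ := h₁.2 k (ε / 2 / C) (by positivity)
  obtain ⟨g₂, hg₂, G₂, hG₂, n₂⟩ := h₂.2 k (min 1 (ε / 2 / (C' + 1))) (by positivity)
  have hP' : Pk k G₂ (D + 1) :=
    Pk_sub h₂.1.sm hG₂.lf.sm hP (n₂.mono (min_le_left _ _))
  refine ⟨g₁ * g₂, Γ.mul_mem hg₁ hg₂, _, hG₁.mul hG₂, ?_⟩
  have a1 := H (fun x => G₁ x - F₁ x) G₂ _ (hG₁.lf.sm.sub h₁.1.sm) hG₂.lf.sm hP' n₁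
  have a2 := H' G₂ F₂ _ hG₂.lf.sm h₂.1.sm hP' (hP.mono (by linarith)) (n₂.mono (min_le_right _ _))
  have a3 := a1.add ((hG₁.lf.comp hG₂.lf).sm.sub (h₁.1.comp hG₂.lf).sm)
    ((h₁.1.comp hG₂.lf).sm.sub (h₁.1.comp h₂.1).sm) a2
  have e : (fun x => G₁ (G₂ x) - F₁ (G₂ x) + (F₁ (G₂ x) - F₁ (F₂ x))) =
      fun x => G₁ (G₂ x) - F₁ (F₂ x) := by ext x; ring
  rw [e] at a3
  refine a3.mono ?_
  have e1 : C * (ε / 2 / C) = ε / 2 := by field_simp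
  have e2 : C' * (ε / 2 / (C' + 1)) ≤ ε / 2 := by
    rw [mul_div_assoc', div_le_iff₀ (by positivity)]
    nlinarith
  linarith

lemma Gc_trans {Γ : Subgroup (Equiv.Perm S1)} {g : Equiv.Perm S1} (hg : g ∈ Γ)
    (h : IsLift g (fun x => x + √2)) (t : ℝ) : Gc Γ (fun x => x + t) := by
  let A : AddSubgroup ℝ :=
    { carrier := {t | ∃ g ∈ Γ, IsLift g (fun x => x + t)}
      zero_mem' := ⟨1, Γ.one_mem, (Lf_add 0).isLift fun x => by simp⟩
      add_mem' := by
        rintro a b ⟨g, hg, h⟩ ⟨g', hg', h'⟩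
        refine ⟨g * g', Γ.mul_mem hg hg', ?_⟩
        have := h.mul h'
        convert this using 2
        ring
      neg_mem' := by
        rintro a ⟨g, hg, h⟩
        exact ⟨g⁻¹, Γ.inv_mem hg, h.inv (Lf_add _) fun x => by ring⟩ }
  have hA : AddSubgroup.closure {√2, 1} ≤ A := by
    rw [AddSubgroup.closure_le]
    rintro x (rfl | rfl)
    · exact ⟨g, hg, h⟩
    · exact ⟨1, Γ.one_mem, (Lf_add 1).isLift fun x => by simp⟩
  have hd : Dense ((AddSubgroup.closure {√2, 1} : AddSubgroup ℝ) : Set ℝ) :=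
    dense_addSubgroupClosure_pair_iff.2 (by simpa using irrational_sqrt_two)
  refine ⟨Lf_add t, fun k ε hε => ?_⟩
  obtain ⟨s, hs, hst⟩ := Metric.dense_iff.1 hd t ε hε
  obtain ⟨g, hg, h⟩ := hA hst
  refine ⟨g, hg, _, h, ?_⟩
  have : (fun x => x + s - (x + t)) = fun _ => s - t := by ext x; ring
  rw [this]
  refine Nk_const.mono ?_
  rw [Metric.mem_ball, Real.dist_eq] at hs
  exact hs.le

structure Tan (Γ : Subgroup (Equiv.Perm S1)) (Y : ℝ → ℝ) : Prop where
  sp : SP Y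
  tan : ∀ k : ℕ, ∀ η : ℝ, 0 < η → ∃ s₀ : ℝ, 0 < s₀ ∧ ∀ s : ℝ, |s| < s₀ →
    ∃ f, Gc Γ f ∧ Nk k (fun x => f x - x - s * Y x) (η * |s|)

lemma SP.add {φ ψ : ℝ → ℝ} (h : SP φ) (h' : SP ψ) : SP (fun x => φ x + ψ x) :=
  ⟨h.sm.add h'.sm, fun x => by rw [h.per, h'.per]⟩

lemma SP.mul {φ ψ : ℝ → ℝ} (h : SP φ) (h' : SP ψ) : SP (fun x => φ x * ψ x) :=
  ⟨h.sm.mul h'.sm, fun x => by rw [h.per, h'.per]⟩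

lemma SP.sub {φ ψ : ℝ → ℝ} (h : SP φ) (h' : SP ψ) : SP (fun x => φ x - ψ x) :=
  ⟨h.sm.sub h'.sm, fun x => by rw [h.per, h'.per]⟩

lemma SP.cmul {φ : ℝ → ℝ} (h : SP φ) (c : ℝ) : SP (fun x => c * φ x) :=
  ⟨contDiff_const.mul h.sm, fun x => by rw [h.per]⟩

lemma SP_const (c : ℝ) : SP (fun _ => c) := ⟨contDiff_const, fun _ => rfl⟩

lemma SP.shift {φ : ℝ → ℝ} (h : SP φ) (c : ℝ) : SP (fun x => φ (x + c)) :=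
  ⟨h.sm.comp (sm_id.add contDiff_const), fun x => by rw [add_right_comm, h.per]⟩

lemma SP.comp {φ F : ℝ → ℝ} (h : SP φ) (hF : Lf F) : SP (fun x => φ (F x)) :=
  ⟨h.sm.comp hF.sm, fun x => by rw [hF.per, h.per]⟩

lemma SP.ab' {φ : ℝ → ℝ} (h : SP φ) (k : ℕ) : ∃ c, 0 ≤ c ∧ Nk k φ c := by
  obtain ⟨c, hc⟩ := h.ab k
  exact ⟨c, hc.nonneg, hc⟩

section
variable {Γ : Subgroup (Equiv.Perm S1)}

lemma Gc_id : Gc Γ (fun x => x) :=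
  Gc_of_mem Γ.one_mem (Lf_id.isLift fun x => by simp)

lemma Tan.cmul {Y : ℝ → ℝ} (h : Tan Γ Y) (c : ℝ) : Tan Γ (fun x => c * Y x) := by
  refine ⟨h.sp.cmul c, fun k η hη => ?_⟩
  by_cases hc : c = 0
  · refine ⟨1, one_pos, fun s _ => ⟨_, Gc_id, Nk_of_zero ?_ (by positivity)⟩⟩
    simp [hc]
  · obtain ⟨s₀, hs₀, H⟩ := h.tan k (η / |c|) (by positivity)
    refine ⟨s₀ / |c|, by positivity, fun s hs => ?_⟩
    rw [lt_div_iff₀ (by positivity), ← abs_mul] at hs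
    obtain ⟨f, hf, hN⟩ := H _ hs
    refine ⟨f, hf, ?_⟩
    have e : η / |c| * |s * c| = η * |s| := by rw [abs_mul]; field_simp
    rw [e] at hN
    convert hN using 3
    ring

lemma Tan.closed {Y : ℝ → ℝ} (hY : SP Y)
    (h : ∀ k : ℕ, ∀ ε : ℝ, 0 < ε → ∃ Y', Tan Γ Y' ∧ Nk k (fun x => Y' x - Y x) ε) : Tan Γ Y := by
  refine ⟨hY, fun k η hη => ?_⟩
  obtain ⟨Y', hY', h1⟩ := h k (η / 2) (by positivity)
  obtain ⟨s₀, hs₀, H⟩ := hY'.tan k (η / 2) (by positivity)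
  refine ⟨s₀, hs₀, fun s hs => ?_⟩
  obtain ⟨f, hf, hN⟩ := H s hs
  refine ⟨f, hf, ?_⟩
  have := hN.add ((hf.1.sm.sub sm_id).sub (hY'.sp.cmul s).sm)
    ((hY'.sp.sub hY).cmul s).sm (h1.cmul (hY'.sp.sub hY).sm s)
  convert this using 2
  · ring
  · ring

lemma Pk_id (k : ℕ) : Pk k (fun x => x) 1 := by
  have : deriv (fun x : ℝ => x) = fun _ => 1 := by ext x; simp
  intro j hj x
  rw [this]
  exact (Nk_const (k := k) j hj.le x).trans (by simp)

lemma Tan.add {Y₁ Y₂ : ℝ → ℝ} (h₁ : Tan Γ Y₁) (h₂ : Tan Γ Y₂) :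
    Tan Γ (fun x => Y₁ x + Y₂ x) := by
  refine ⟨h₁.sp.add h₂.sp, fun k η hη => ?_⟩
  obtain ⟨C, hC, H⟩ := Nk_comp k (1 + 1)
  obtain ⟨C', hC', H'⟩ := Nk_lip k (1 + 1) Y₁ h₁.sp.sm h₁.sp.der.ab
  obtain ⟨c, hc, hc2⟩ := h₂.sp.ab' k
  obtain ⟨s₁, hs₁, K₁⟩ := h₁.tan k (η / 3 / C) (by positivity)
  obtain ⟨s₂, hs₂, K₂⟩ := h₂.tan k (min 1 (η / 3)) (by positivity)
  refine ⟨min (min s₁ s₂) (min (1 / (1 + c)) (η / 3 / ((C' + 1) * (1 + c)))), by positivity,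
    fun s hs => ?_⟩
  rw [lt_min_iff, lt_min_iff, lt_min_iff] at hs
  obtain ⟨⟨hs1, hs2⟩, hs3, hs4⟩ := hs
  rw [lt_div_iff₀ (by positivity)] at hs3 hs4
  obtain ⟨f, hf, nf⟩ := K₁ s hs1
  obtain ⟨g, hg, ng⟩ := K₂ s hs2
  refine ⟨_, hf.comp hg, ?_⟩
  have hs0 := abs_nonneg s
  have n1 : Nk k (fun x => g x - x) (|s| * (1 + c)) := by
    have := (ng.mono (mul_le_mul_of_nonneg_right (min_le_left _ _) hs0)).add
      ((hg.1.sm.sub sm_id).sub (h₂.sp.cmul s).sm) (h₂.sp.cmul s).sm (hc2.cmul h₂.sp.sm s)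
    convert this using 2
    · ring
    · ring
  have hP : Pk k g (1 + 1) := Pk_sub sm_id hg.1.sm (Pk_id k) (n1.mono hs3.le)
  have a1 := H (fun x => f x - x - s * Y₁ x) g _
    ((hf.1.sm.sub sm_id).sub (h₁.sp.cmul s).sm) hg.1.sm hP nf
  have a2 := H' g (fun x => x) _ hg.1.sm sm_id hP ((Pk_id k).mono (by norm_num)) n1
  have a3 := a2.cmul ((h₁.sp.comp hg.1).sub h₁.sp).sm s
  have a4 := ng.mono (mul_le_mul_of_nonneg_right (min_le_right _ _) hs0)
  have s1 : Sm (fun x => f (g x) - g x - s * Y₁ (g x)) :=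
    ((hf.1.comp hg.1).sm.sub hg.1.sm).sub ((h₁.sp.comp hg.1).cmul s).sm
  have s2 : Sm (fun x => s * (Y₁ (g x) - Y₁ x)) := (((h₁.sp.comp hg.1).sub h₁.sp).cmul s).sm
  have s3 : Sm (fun x => g x - x - s * Y₂ x) := (hg.1.sm.sub sm_id).sub (h₂.sp.cmul s).sm
  have a5 := (a1.add s1 s2 a3).add (s1.add s2) s3 a4
  have e : (fun x => f (g x) - g x - s * Y₁ (g x) + s * (Y₁ (g x) - Y₁ x) +
      (g x - x - s * Y₂ x)) = fun x => f (g x) - x - s * (Y₁ x + Y₂ x) := by ext x; ring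
  rw [e] at a5
  refine a5.mono ?_
  have e1 : C * (η / 3 / C * |s|) = η / 3 * |s| := by field_simp
  have e2 : C' * (|s| * (1 + c)) ≤ η / 3 := by nlinarith [mul_nonneg hs0 (by linarith : 0 ≤ 1 + c)]
  have e3 := mul_le_mul_of_nonneg_left e2 hs0
  rw [e1]
  linarith

lemma Tan.shift (hR : ∀ t, Gc Γ (fun x => x + t)) {Y : ℝ → ℝ} (h : Tan Γ Y) (c : ℝ) :
    Tan Γ (fun x => Y (x + c)) := by
  refine ⟨h.sp.shift c, fun k η hη => ?_⟩
  obtain ⟨s₀, hs₀, H⟩ := h.tan k η hη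
  refine ⟨s₀, hs₀, fun s hs => ?_⟩
  obtain ⟨f, hf, hN⟩ := H s hs
  refine ⟨_, (hR (-c)).comp (hf.comp (hR c)), ?_⟩
  convert hN.shift c using 2
  ring

lemma Tan_zero : Tan Γ (fun _ => 0) :=
  ⟨SP_const 0, fun k η hη => ⟨1, one_pos, fun s _ =>
    ⟨_, Gc_id, Nk_of_zero (by simp) (by positivity)⟩⟩⟩

lemma Tan.sum {ι : Type*} (I : Finset ι) {Y : ι → ℝ → ℝ} (h : ∀ i ∈ I, Tan Γ (Y i)) :
    Tan Γ (fun x => ∑ i ∈ I, Y i x) := by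
  classical
  induction I using Finset.induction_on with
  | empty => simpa using Tan_zero
  | insert a I ha ih =>
    simp only [Finset.sum_insert ha]
    exact (h a (by simp)).add (ih fun i hi => h i (by simp [hi]))

lemma taylor_Nk {k : ℕ} {χ : ℝ → ℝ} {c : ℝ} (hχ : Sm χ) (h : Nk (k + 1) (deriv χ) c) (s : ℝ) :
    Nk k (fun y => χ (y + s) - χ y - s * deriv χ y) (c * s ^ 2) := by
  have base : ∀ x, |χ (x + s) - χ x - s * deriv χ x| ≤ c * s ^ 2 := fun x =>
    taylor_bd hχ (fun x => (Nk_succ.1 h).2.bd x) x s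
  induction k generalizing χ with
  | zero => rwa [Nk_zero]
  | succ k ih =>
    rw [Nk_succ]
    refine ⟨base, ?_⟩
    have h' := (Nk_succ.1 h).2
    have e : deriv (fun y => χ (y + s) - χ y - s * deriv χ y) =
        fun y => deriv χ (y + s) - deriv χ y - s * deriv (deriv χ) y := by
      ext y
      have d1 : HasDerivAt (fun y => χ (y + s)) (deriv χ (y + s)) y :=
        (hχ.dif (y + s)).hasDerivAt.comp_add_const y s
      exact ((d1.sub (hχ.dif y).hasDerivAt).sub
        ((hχ.der.dif y).hasDerivAt.const_mul s)).deriv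
    rw [e]
    exact ih hχ.der h' fun x => taylor_bd hχ.der (fun x => (Nk_succ.1 h').2.bd x) x s

lemma Tan_flow (hR : ∀ t, Gc Γ (fun x => x + t)) {ψ χ : ℝ → ℝ} (hψ : Gc Γ ψ) (hχ : Gc Γ χ)
    (hl : ∀ x, χ (ψ x) = x) : Tan Γ (fun x => deriv χ (ψ x)) := by
  refine ⟨hχ.1.der.comp hψ.1, fun k η hη => ?_⟩
  obtain ⟨D, hD, hP⟩ := hψ.1.pk k
  obtain ⟨C, hC, H⟩ := Nk_comp k D
  obtain ⟨c, hc0, hc⟩ := hχ.1.der.ab' (k + 1)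
  refine ⟨η / (C * (c + 1)), by positivity, fun s hs => ?_⟩
  rw [lt_div_iff₀ (by positivity)] at hs
  refine ⟨_, hχ.comp ((hR s).comp hψ), ?_⟩
  have hs0 := abs_nonneg s
  have a1 := H _ ψ _ (((hχ.1.comp (Lf_add s)).sm.sub hχ.1.sm).sub (hχ.1.der.cmul s).sm) hψ.1.sm hP
    (taylor_Nk hχ.1.sm hc s)
  simp only [hl] at a1
  refine a1.mono ?_
  rw [← sq_abs]
  have : 0 ≤ C * |s| := by positivity
  nlinarith

end
open Real in
lemma sm_cos (w φ : ℝ) : Sm (fun x => Real.cos (w * x + φ)) :=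
  Real.contDiff_cos.comp ((contDiff_const.mul contDiff_id).add contDiff_const)

lemma deriv_cosw (w φ : ℝ) : deriv (fun x => Real.cos (w * x + φ)) =
    fun x => w * Real.cos (w * x + (φ + Real.pi / 2)) := by
  ext x
  have h : HasDerivAt (fun x => Real.cos (w * x + φ)) (-Real.sin (w * x + φ) * (w * 1)) x :=
    (((hasDerivAt_id x).const_mul w).add_const φ).cos
  rw [h.deriv, ← add_assoc, Real.cos_add_pi_div_two]
  ring

lemma Nk_cos (k : ℕ) (w φ : ℝ) : Nk k (fun x => Real.cos (w * x + φ)) ((1 + |w|) ^ k) := by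
  induction k generalizing φ with
  | zero => rw [Nk_zero]; intro x; simpa using Real.abs_cos_le_one _
  | succ k ih =>
    rw [Nk_succ]
    have h0 := abs_nonneg w
    refine ⟨fun x => (Real.abs_cos_le_one _).trans (one_le_pow₀ (by linarith)), ?_⟩
    rw [deriv_cosw]
    refine ((ih _).cmul (sm_cos _ _) w).mono ?_
    have : 0 ≤ (1 + |w|) ^ k := by positivity
    rw [pow_succ]
    nlinarith

def cz (n : ℤ) (φ : ℝ) : ℝ → ℝ := fun x => Real.cos (2 * Real.pi * n * x + φ)

lemma SP_cz (n : ℤ) (φ : ℝ) : SP (cz n φ) := by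
  refine ⟨sm_cos _ _, fun x => ?_⟩
  unfold cz
  rw [← Real.cos_add_int_mul_two_pi (2 * Real.pi * n * x + φ) n]
  congr 1
  ring

def aa : ℝ → ℝ := fun x =>
  (1 - Real.cos (2 * Real.pi * x) / 2) / (5 / 4 - Real.cos (2 * Real.pi * x))

def bb : ℝ → ℝ := fun x =>
  (Real.sin (2 * Real.pi * x) / 2) / (5 / 4 - Real.cos (2 * Real.pi * x))

lemma den_pos (x : ℝ) : 0 < 5 / 4 - Real.cos (2 * Real.pi * x) := by
  linarith [Real.cos_le_one (2 * Real.pi * x)]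

lemma sm_cos1 : Sm (fun x => Real.cos (2 * Real.pi * x)) := by
  simpa using sm_cos (2 * Real.pi) 0

lemma sm_sin1 : Sm (fun x => Real.sin (2 * Real.pi * x)) :=
  Real.contDiff_sin.comp (contDiff_const.mul contDiff_id)

lemma per_cos1 (x : ℝ) : Real.cos (2 * Real.pi * (x + 1)) = Real.cos (2 * Real.pi * x) := by
  rw [mul_add, mul_one, Real.cos_add_two_pi]

lemma per_sin1 (x : ℝ) : Real.sin (2 * Real.pi * (x + 1)) = Real.sin (2 * Real.pi * x) := by
  rw [mul_add, mul_one, Real.sin_add_two_pi]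

lemma SP_aa : SP aa := by
  refine ⟨?_, fun x => by unfold aa; rw [per_cos1]⟩
  exact (contDiff_const.sub (sm_cos1.div_const 2)).div (contDiff_const.sub sm_cos1)
    fun x => (den_pos x).ne'

lemma SP_bb : SP bb := by
  refine ⟨?_, fun x => by unfold bb; rw [per_cos1, per_sin1]⟩
  exact (sm_sin1.div_const 2).div (contDiff_const.sub sm_cos1) fun x => (den_pos x).ne'

lemma aa_pos (x : ℝ) : 0 < aa x :=
  div_pos (by linarith [Real.cos_le_one (2 * Real.pi * x)]) (den_pos x)

def RR (M : ℕ) : ℝ → ℝ := fun x =>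
  (1 / 2) ^ M * (cz M 0 x * aa x + cz M (Real.pi / 2) x * bb x)

lemma SP_RR (M : ℕ) : SP (RR M) :=
  (((SP_cz _ _).mul SP_aa).add ((SP_cz _ _).mul SP_bb)).cmul _

lemma RR_zero : RR 0 = aa := by
  ext x
  simp [RR, cz]

lemma RR_succ (M : ℕ) (x : ℝ) : RR M x = (1 / 2) ^ M * cz M 0 x + RR (M + 1) x := by
  have hd := (den_pos x).ne'
  have hcs := Real.sin_sq_add_cos_sq (2 * Real.pi * x)
  simp only [RR, cz, Real.cos_add_pi_div_two, add_zero]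
  have e : 2 * Real.pi * (((M + 1 : ℕ) : ℤ) : ℝ) * x =
    2 * Real.pi * ((M : ℤ) : ℝ) * x + 2 * Real.pi * x := by push_cast; ring
  rw [e, Real.cos_add, Real.sin_add, pow_succ]
  have h1 : aa x * (1 - Real.cos (2 * Real.pi * x) / 2) +
      bb x * (Real.sin (2 * Real.pi * x) / 2) = 1 := by
    unfold aa bb
    rw [div_mul_eq_mul_div, div_mul_eq_mul_div, ← add_div, div_eq_one_iff_eq hd]
    nlinarith
  have h2 : bb x * (1 - Real.cos (2 * Real.pi * x) / 2) =
      aa x * (Real.sin (2 * Real.pi * x) / 2) := by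
    unfold aa bb
    ring
  generalize Real.cos (2 * Real.pi * ((M : ℤ) : ℝ) * x) = C
  generalize Real.sin (2 * Real.pi * ((M : ℤ) : ℝ) * x) = S
  generalize ((1 : ℝ) / 2) ^ M = p
  linear_combination (p * C) * h1 - (p * S) * h2

lemma aa_eq (M : ℕ) (x : ℝ) :
    aa x = ∑ m ∈ Finset.range M, (1 / 2) ^ m * cz m 0 x + RR M x := by
  induction M with
  | zero => simp [RR_zero]
  | succ M ih => rw [ih, Finset.sum_range_succ, RR_succ M]; ring

lemma RR_small (k : ℕ) (ε : ℝ) (hε : 0 < ε) : ∃ M₀ : ℕ, ∀ M ≥ M₀, Nk k (RR M) ε := by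
  obtain ⟨a, ha0, ha⟩ := SP_aa.ab' k
  obtain ⟨b, hb0, hb⟩ := SP_bb.ab' k
  have hN : ∀ M : ℕ, Nk k (RR M)
      ((1 / 2) ^ M * (2 ^ k * ((1 + 2 * Real.pi * M) ^ k * (a + b)))) := by
    intro M
    have h1 := (Nk_cos k (2 * Real.pi * (M : ℤ)) 0).mul (SP_cz M 0).sm SP_aa.sm ha
    have h2 := (Nk_cos k (2 * Real.pi * (M : ℤ)) (Real.pi / 2)).mul
      (SP_cz M (Real.pi / 2)).sm SP_bb.sm hb
    have h3 := (h1.add ((SP_cz M 0).mul SP_aa).sm ((SP_cz M (Real.pi / 2)).mul SP_bb).sm h2).cmul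
      (((SP_cz M 0).mul SP_aa).add ((SP_cz M (Real.pi / 2)).mul SP_bb)).sm ((1 / 2) ^ M)
    refine h3.mono (le_of_eq ?_)
    have e1 : |2 * Real.pi * ((M : ℤ) : ℝ)| = 2 * Real.pi * M := by
      rw [abs_of_nonneg (by have := Real.pi_pos; positivity)]; simp
    rw [e1, abs_of_nonneg (by positivity)]
    ring
  have ht : Tendsto (fun M : ℕ => (2 ^ k * (8 ^ k * (a + b))) * ((M : ℝ) ^ k * (1 / 2) ^ M))
      atTop (𝓝 ((2 ^ k * (8 ^ k * (a + b))) * 0)) :=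
    (tendsto_pow_const_mul_const_pow_of_abs_lt_one k
      (by rw [abs_of_pos] <;> norm_num)).const_mul _
  rw [mul_zero] at ht
  obtain ⟨M₀, h⟩ := eventually_atTop.1 (ht.eventually (gt_mem_nhds hε))
  refine ⟨max M₀ 1, fun M hM => (hN M).mono ?_⟩
  refine le_trans ?_ (h M (le_trans (le_max_left _ _) hM)).le
  have hM1 : (1 : ℝ) ≤ M := by exact_mod_cast le_trans (le_max_right _ _) hM
  have : (1 + 2 * Real.pi * M) ^ k ≤ 8 ^ k * (M : ℝ) ^ k := by
    rw [← mul_pow]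
    have := Real.pi_pos
    refine pow_le_pow_left₀ (by positivity) ?_ k
    nlinarith [Real.pi_lt_d2]
  calc (1 / 2 : ℝ) ^ M * (2 ^ k * ((1 + 2 * Real.pi * M) ^ k * (a + b)))
      ≤ (1 / 2 : ℝ) ^ M * (2 ^ k * ((8 ^ k * (M : ℝ) ^ k) * (a + b))) := by gcongr
    _ = _ := by ring

lemma sum_cos_zero (N : ℕ) (l : ℤ) (α : ℝ) (hN : 0 < N) (hl : ¬ (N : ℤ) ∣ l) :
    ∑ j ∈ Finset.range N, Real.cos (α + 2 * Real.pi * l * (j / N)) = 0 := by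
  set β : ℝ := 2 * Real.pi * l / N with hβ
  have hN' : (N : ℝ) ≠ 0 := by positivity
  have key : ∀ n : ℕ, 2 * Real.sin (β / 2) *
      ∑ j ∈ Finset.range n, Real.cos (α + 2 * Real.pi * l * (j / N)) =
      Real.sin (α + β * n - β / 2) - Real.sin (α - β / 2) := by
    intro n
    induction n with
    | zero => simp
    | succ n ih =>
      rw [Finset.sum_range_succ, mul_add, ih]
      have e1 : α + 2 * Real.pi * l * (n / N) = α + β * n := by rw [hβ]; ring
      have e2 : α + β * ((n + 1 : ℕ) : ℝ) - β / 2 = α + β * n + β / 2 := by push_cast; ring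
      rw [e1, e2, Real.sin_add (α + β * n), Real.sin_sub (α + β * n)]
      ring
  have h := key N
  have e : α + β * N - β / 2 = α - β / 2 + l * (2 * Real.pi) := by
    rw [hβ]; field_simp; ring
  rw [e, Real.sin_add_int_mul_two_pi, sub_self] at h
  have hs : Real.sin (β / 2) ≠ 0 := by
    rw [Ne, Real.sin_eq_zero_iff]
    rintro ⟨m, hm⟩
    apply hl
    refine ⟨m, ?_⟩
    rw [hβ] at hm
    have h3 : (l : ℝ) = N * m := by
      have := Real.pi_ne_zero
      field_simp at hm
      linarith
    exact_mod_cast h3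
  rcases mul_eq_zero.1 h with h | h
  · exact absurd h (by simpa using hs)
  · exact h

lemma avg_cos (N n m : ℕ) (hn : 0 < n) (hN : m + n < N) (x : ℝ) :
    ∑ j ∈ Finset.range N, Real.cos (2 * Real.pi * n * ((j : ℝ) / N)) * cz m 0 (x + (j : ℝ) / N) =
      if m = n then N / 2 * cz n 0 x else 0 := by
  have e : ∀ j : ℕ, Real.cos (2 * Real.pi * n * ((j : ℝ) / N)) * cz m 0 (x + (j : ℝ) / N) =
      1 / 2 * Real.cos (2 * Real.pi * m * x + 2 * Real.pi * ((m + n : ℕ) : ℤ) * ((j : ℝ) / N)) +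
      1 / 2 * Real.cos (2 * Real.pi * m * x + 2 * Real.pi * ((m - n : ℤ) : ℤ) * ((j : ℝ) / N)) := by
    intro j
    unfold cz
    have e1 : 2 * Real.pi * m * x + 2 * Real.pi * ((m + n : ℕ) : ℤ) * ((j : ℝ) / N) =
      (2 * Real.pi * (m : ℤ) * (x + (j : ℝ) / N) + 0) + 2 * Real.pi * n * ((j : ℝ) / N) := by
      push_cast; ring
    have e2 : 2 * Real.pi * m * x + 2 * Real.pi * ((m - n : ℤ) : ℤ) * ((j : ℝ) / N) =
      (2 * Real.pi * (m : ℤ) * (x + (j : ℝ) / N) + 0) - 2 * Real.pi * n * ((j : ℝ) / N) := by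
      push_cast; ring
    rw [e1, e2, Real.cos_add (_ + 0), Real.cos_sub]
    ring
  rw [Finset.sum_congr rfl fun j _ => e j, Finset.sum_add_distrib, ← Finset.mul_sum,
    ← Finset.mul_sum, sum_cos_zero N _ _ (by omega)]
  · split_ifs with h
    · subst h
      simp [cz]
      ring
    · rw [sum_cos_zero N _ _ (by omega)]
      · simp
      · intro hd
        have := Int.eq_zero_of_abs_lt_dvd hd (by rw [abs_lt]; constructor <;> omega)
        omega
  · intro hd
    have := Int.le_of_dvd (by omega) hd
    omega

lemma Nk_sum {ι : Type*} {k : ℕ} (I : Finset ι) {Y : ι → ℝ → ℝ} {c : ι → ℝ}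
    (hs : ∀ i ∈ I, Sm (Y i)) (h : ∀ i ∈ I, Nk k (Y i) (c i)) :
    Nk k (fun x => ∑ i ∈ I, Y i x) (∑ i ∈ I, c i) := by
  classical
  induction I using Finset.induction_on with
  | empty => exact Nk_of_zero (by simp) (by simp)
  | insert a I ha ih =>
    simp only [Finset.sum_insert ha]
    exact (h a (by simp)).add (hs a (by simp)) (ContDiff.sum fun i hi => hs i (by simp [hi]))
      (ih (fun i hi => hs i (by simp [hi])) fun i hi => h i (by simp [hi]))

section
variable {Γ : Subgroup (Equiv.Perm S1)}

lemma Tan_cos_pos (hR : ∀ t, Gc Γ (fun x => x + t)) (ha : Tan Γ aa) (n : ℕ) (hn : 0 < n) :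
    Tan Γ (cz n 0) := by
  refine Tan.closed (SP_cz _ _) fun k ε hε => ?_
  obtain ⟨M₀, hM₀⟩ := RR_small k (ε / 2 ^ (n + 1)) (by positivity)
  set M := max M₀ (n + 1) with hM
  have hR' := hM₀ M (le_max_left _ _)
  have hMn : n < M := Nat.lt_of_succ_le (le_max_right M₀ (n + 1))
  set N := M + n with hN
  have hNpos : (0 : ℝ) < N := by
    have : 0 < N := by omega
    exact_mod_cast this
  set w : ℕ → ℝ := fun j => 2 ^ (n + 1) / N * Real.cos (2 * Real.pi * n * ((j : ℝ) / N)) with hw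
  refine ⟨fun x => ∑ j ∈ Finset.range N, w j * aa (x + (j : ℝ) / N),
    Tan.sum _ fun j _ => (ha.shift hR _).cmul _, ?_⟩
  have e : (fun x => ∑ j ∈ Finset.range N, w j * aa (x + (j : ℝ) / N) - cz n 0 x) =
      fun x => ∑ j ∈ Finset.range N, w j * RR M (x + (j : ℝ) / N) := by
    ext x
    have e1 : ∀ j ∈ Finset.range N, w j * aa (x + (j : ℝ) / N) =
        ∑ m ∈ Finset.range M, 2 ^ (n + 1) / N * (1 / 2) ^ m *
          (Real.cos (2 * Real.pi * n * ((j : ℝ) / N)) * cz m 0 (x + (j : ℝ) / N)) +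
        w j * RR M (x + (j : ℝ) / N) := by
      intro j _
      rw [aa_eq M, mul_add, Finset.mul_sum]
      congr 1
      refine Finset.sum_congr rfl fun m _ => ?_
      rw [hw]; ring
    rw [Finset.sum_congr rfl e1, Finset.sum_add_distrib, Finset.sum_comm]
    have e2 : ∀ m ∈ Finset.range M, ∑ j ∈ Finset.range N, 2 ^ (n + 1) / N * (1 / 2 : ℝ) ^ m *
          (Real.cos (2 * Real.pi * n * ((j : ℝ) / N)) * cz m 0 (x + (j : ℝ) / N)) =
        if m = n then cz n 0 x else 0 := by
      intro m hm
      rw [Finset.mem_range] at hm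
      rw [← Finset.mul_sum, avg_cos N n m hn (by omega)]
      split_ifs with h
      · subst h
        rw [one_div, inv_pow]
        field_simp
        ring
      · simp
    rw [Finset.sum_congr rfl e2, Finset.sum_ite_eq' , if_pos (Finset.mem_range.2 hMn)]
    ring
  rw [e]
  have h1 := Nk_sum (k := k) (Finset.range N) (Y := fun j x => w j * RR M (x + (j : ℝ) / N))
    (c := fun _ => ε / N) (fun j _ => (((SP_RR M).shift _).cmul _).sm) fun j _ => by
      refine ((hR'.shift ((j : ℝ) / N)).cmul ((SP_RR M).shift _).sm (w j)).mono ?_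
      have : |w j| ≤ 2 ^ (n + 1) / N := by
        rw [hw, abs_mul, abs_of_pos (by positivity : (0 : ℝ) < 2 ^ (n + 1) / N)]
        exact mul_le_of_le_one_right (by positivity) (Real.abs_cos_le_one _)
      refine (mul_le_mul_of_nonneg_right this (by positivity)).trans (le_of_eq ?_)
      field_simp
  refine h1.mono (le_of_eq ?_)
  rw [Finset.sum_const, Finset.card_range, nsmul_eq_mul]
  field_simp

lemma Tan_one (hR : ∀ t, Gc Γ (fun x => x + t)) (c : ℝ) : Tan Γ (fun _ => c) :=
  ⟨SP_const c, fun k η hη => ⟨1, one_pos, fun s _ =>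
    ⟨_, hR (s * c), Nk_of_zero (by intro x; ring) (by positivity)⟩⟩⟩

lemma Tan_cz (hR : ∀ t, Gc Γ (fun x => x + t)) (ha : Tan Γ aa) (n : ℤ) (φ : ℝ) :
    Tan Γ (cz n φ) := by
  have pos : ∀ n : ℕ, 0 < n → ∀ φ, Tan Γ (cz n φ) := by
    intro n hn φ
    convert (Tan_cos_pos hR ha n hn).shift hR (φ / (2 * Real.pi * n)) using 1
    ext x
    unfold cz
    congr 1
    have := Real.pi_ne_zero
    have : (n : ℝ) ≠ 0 := by positivity
    push_cast
    field_simp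
    ring
  rcases lt_trichotomy n 0 with h | h | h
  · obtain ⟨m, rfl⟩ : ∃ m : ℕ, n = -m := ⟨n.natAbs, by omega⟩
    convert pos m (by omega) (-φ) using 1
    ext x
    unfold cz
    rw [← Real.cos_neg]
    congr 1
    push_cast; ring
  · subst h
    convert Tan_one hR (Real.cos φ) using 1
    ext x; simp [cz]
  · lift n to ℕ using h.le
    exact pos n (by omega) φ

end
def TP : Submodule ℝ (ℝ → ℝ) := Submodule.span ℝ (range fun p : ℤ × ℝ => cz p.1 p.2)

lemma cz_mem (n : ℤ) (φ : ℝ) : cz n φ ∈ TP := Submodule.subset_span ⟨(n, φ), rfl⟩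

lemma const_mem (c : ℝ) : (fun _ => c) ∈ TP := by
  convert TP.smul_mem c (cz_mem 0 0) using 1
  ext x; simp [cz]

lemma TP_SP {p : ℝ → ℝ} (hp : p ∈ TP) : SP p := by
  induction hp using Submodule.span_induction with
  | mem x h => obtain ⟨p, rfl⟩ := h; exact SP_cz _ _
  | zero => exact SP_const 0
  | add x y _ _ h1 h2 => exact h1.add h2
  | smul a x _ h => exact h.cmul a

lemma TP_anti {p : ℝ → ℝ} (hp : p ∈ TP) : ∃ c : ℝ, ∃ q ∈ TP, deriv q = fun x => p x - c := by
  induction hp using Submodule.span_induction with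
  | mem x h =>
    obtain ⟨⟨n, φ⟩, rfl⟩ := h
    by_cases hn : n = 0
    · subst hn
      refine ⟨Real.cos φ, fun _ => 0, const_mem 0, ?_⟩
      ext x; simp [cz]
    · refine ⟨0, (1 / (2 * Real.pi * n)) • cz n (φ - Real.pi / 2), TP.smul_mem _ (cz_mem _ _), ?_⟩
      have : ((1 / (2 * Real.pi * n)) • cz n (φ - Real.pi / 2)) =
        fun x => (1 / (2 * Real.pi * n)) * Real.cos (2 * Real.pi * n * x + (φ - Real.pi / 2)) := rfl
      rw [this]
      ext x
      rw [deriv_const_mul _ ((sm_cos _ _).dif x), deriv_cosw]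
      have h1 : (n : ℝ) ≠ 0 := by exact_mod_cast hn
      have := Real.pi_ne_zero
      simp only [cz, sub_add_cancel, sub_zero]
      field_simp
  | zero => exact ⟨0, fun _ => 0, const_mem 0, by ext x; simp⟩
  | add x y hx hy h1 h2 =>
    obtain ⟨c, q, hq, e⟩ := h1
    obtain ⟨c', q', hq', e'⟩ := h2
    refine ⟨c + c', q + q', TP.add_mem hq hq', ?_⟩
    ext z
    rw [deriv_add ((TP_SP hq).sm.dif z) ((TP_SP hq').sm.dif z), e, e']
    simp only [Pi.add_apply]; ring
  | smul a x hx h =>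
    obtain ⟨c, q, hq, e⟩ := h
    refine ⟨a * c, a • q, TP.smul_mem a hq, ?_⟩
    ext z
    have : a • q = fun x => a * q x := rfl
    rw [this, deriv_const_mul _ ((TP_SP hq).sm.dif z), e]
    simp only [Pi.smul_apply, smul_eq_mul]; ring

lemma TP_dense0 {u : ℝ → ℝ} (hu : SP u) (ε : ℝ) (hε : 0 < ε) : ∃ p ∈ TP, ∀ x, |u x - p x| ≤ ε := by
  have hp : Function.Periodic u 1 := hu.per
  have hp' : Function.Periodic (fun x => (u x : ℂ)) 1 := fun x => by simp [hu.per]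
  have hc : Continuous (hp'.lift : AddCircle (1 : ℝ) → ℂ) :=
    continuous_coinduced_dom.2 (Complex.continuous_ofReal.comp hu.sm.continuous)
  let U : C(AddCircle (1 : ℝ), ℂ) := ⟨hp'.lift, hc⟩
  have hU : ∀ x : ℝ, U (x : AddCircle (1 : ℝ)) = u x := fun x => hp'.lift_coe x
  haveI : Fact ((0 : ℝ) < 1) := ⟨one_pos⟩
  have hm : U ∈ (Submodule.span ℂ (range (fourier (T := (1 : ℝ))))).topologicalClosure := by
    rw [span_fourier_closure_eq_top]; trivial
  obtain ⟨f, hf, hd⟩ := Metric.mem_closure_iff.1 hm ε hε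
  have key : (fun x : ℝ => (f (x : AddCircle (1 : ℝ))).re) ∈ TP ∧
      (fun x : ℝ => (f (x : AddCircle (1 : ℝ))).im) ∈ TP := by
    clear hd
    have hf' : f ∈ Submodule.span ℂ (range (fourier (T := (1 : ℝ)))) := hf
    clear hf
    induction hf' using Submodule.span_induction with
    | mem x h =>
      obtain ⟨n, rfl⟩ := h
      have e : ∀ x : ℝ, fourier n (x : AddCircle (1 : ℝ)) =
          Complex.exp ((2 * Real.pi * n * x : ℝ) * Complex.I) := by
        intro x
        rw [fourier_coe_apply]
        congr 1
        push_cast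
        ring
      constructor
      · convert cz_mem n 0 using 1
        ext x
        rw [e, Complex.exp_ofReal_mul_I_re]
        simp [cz]
      · convert cz_mem n (-(Real.pi / 2)) using 1
        ext x
        rw [e, Complex.exp_ofReal_mul_I_im]
        unfold cz
        rw [← sub_eq_add_neg, Real.cos_sub_pi_div_two]
    | zero => exact ⟨const_mem 0, const_mem 0⟩
    | add x y _ _ h1 h2 => exact ⟨TP.add_mem h1.1 h2.1, TP.add_mem h1.2 h2.2⟩
    | smul a x _ h =>
      constructor
      · convert TP.sub_mem (TP.smul_mem a.re h.1) (TP.smul_mem a.im h.2) using 1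
        ext z
        simp
      · convert TP.add_mem (TP.smul_mem a.re h.2) (TP.smul_mem a.im h.1) using 1
        ext z
        simp
  refine ⟨_, key.1, fun x => ?_⟩
  have h1 : ‖(U - f) (x : AddCircle (1 : ℝ))‖ ≤ ‖U - f‖ := ContinuousMap.norm_coe_le_norm _ _
  rw [dist_eq_norm] at hd
  have h2 := Complex.abs_re_le_norm ((U - f) (x : AddCircle (1 : ℝ)))
  rw [ContinuousMap.sub_apply, hU, Complex.sub_re, Complex.ofReal_re] at h2
  rw [ContinuousMap.sub_apply, hU] at h1
  exact h2.trans (h1.trans hd.le)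

lemma TP_dense (k : ℕ) : ∀ {u : ℝ → ℝ}, SP u → ∀ ε : ℝ, 0 < ε →
    ∃ p ∈ TP, Nk k (fun x => u x - p x) ε := by
  induction k with
  | zero =>
    intro u hu ε hε
    obtain ⟨p, hp, h⟩ := TP_dense0 hu ε hε
    exact ⟨p, hp, Nk_zero.2 h⟩
  | succ k ih =>
    intro u hu ε hε
    obtain ⟨p, hp, h⟩ := ih hu.der (ε / 2) (by positivity)
    obtain ⟨c, q, hq, e⟩ := TP_anti hp
    have hv : SP (fun x => u x - q x) := hu.sub (TP_SP hq)
    have dv : deriv (fun x => u x - q x) = fun x => deriv u x - p x + c := by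
      ext x
      have := deriv_fun_sub (hu.sm.dif x) ((TP_SP hq).sm.dif x)
      rw [this, e]; ring
    obtain ⟨ξ, _, hξ⟩ := exists_deriv_eq_zero (f := fun x => u x - q x) (zero_lt_one)
      hv.sm.continuous.continuousOn (by simpa using (hv.per 0).symm)
    rw [dv] at hξ
    have hc : |c| ≤ ε / 2 := by
      have h1 := h.bd ξ
      have : c = -(deriv u ξ - p ξ) := by linarith
      rw [this, abs_neg]; exact h1
    have hN : Nk k (deriv (fun x => u x - q x)) ε := by
      rw [dv]
      refine (h.add (hu.der.sub (TP_SP hp)).sm contDiff_const Nk_const).mono ?_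
      linarith
    refine ⟨(q + (fun _ => (u 0 - q 0)) : ℝ → ℝ), TP.add_mem hq (const_mem _), ?_⟩
    have e2 : (fun x => u x - (q + (fun _ => (u 0 - q 0)) : ℝ → ℝ) x) =
        fun x => (u x - q x) - (u 0 - q 0) := by
      ext x; simp only [Pi.add_apply]; ring
    rw [e2, Nk_succ]
    constructor
    · intro x
      have hp : Function.Periodic (fun x => u x - q x) 1 := hv.per
      obtain ⟨y, hy, hxy⟩ := hp.exists_mem_Ico₀ one_pos x
      have hxy' : u x - q x = u y - q y := hxy
      rw [hxy']
      refine (mvt_bd hv.sm.dif hN.bd 0 y).trans ?_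
      rw [sub_zero, abs_of_nonneg hy.1]
      nlinarith [hy.2]
    · rw [deriv_sub_const_fun]
      exact hN

lemma exists_psi : ∃ ψ : ℝ → ℝ, Lf ψ ∧ ∃ c : ℝ, 0 < c ∧ ∀ x, deriv ψ x = 1 / (c * aa x) := by
  have hs : SP (fun x => (aa x)⁻¹) :=
    ⟨SP_aa.sm.inv fun x => (aa_pos x).ne', fun x => by rw [SP_aa.per]⟩
  set g : ℝ → ℝ := fun x => (aa x)⁻¹ with hg
  have hpos : ∀ x, 0 < g x := fun x => inv_pos.2 (aa_pos x)
  have hcont : Continuous g := hs.sm.continuous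
  have hi : ∀ a b, IntervalIntegrable g MeasureTheory.volume a b :=
    fun a b => hcont.intervalIntegrable a b
  set c := ∫ x in (0 : ℝ)..1, g x with hc
  have hc0 : 0 < c := intervalIntegral.intervalIntegral_pos_of_pos (hi 0 1) hpos one_pos
  have hd : ∀ x, HasDerivAt (fun x => 1 / c * ∫ y in (0 : ℝ)..x, g y) (1 / c * g x) x := fun x =>
    (intervalIntegral.integral_hasDerivAt_right (hi 0 x)
      (hcont.stronglyMeasurableAtFilter _ _) hcont.continuousAt).const_mul _
  have hder : deriv (fun x => 1 / c * ∫ y in (0 : ℝ)..x, g y) = fun x => 1 / c * g x :=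
    funext fun x => (hd x).deriv
  refine ⟨fun x => 1 / c * ∫ y in (0 : ℝ)..x, g y, ⟨?_, fun x => ?_, fun x => ?_⟩, c, hc0, fun x => ?_⟩
  · refine contDiff_infty_iff_deriv.2 ⟨fun x => (hd x).differentiableAt, ?_⟩
    rw [hder]
    exact (hs.cmul _).sm
  · have hp : Function.Periodic g 1 := hs.per
    have h1 := hp.intervalIntegral_add_eq x 0
    rw [zero_add] at h1
    have h2 := intervalIntegral.integral_add_adjacent_intervals (hi 0 x) (hi x (x + 1))
    rw [h1, ← hc] at h2
    rw [← h2]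
    field_simp
  · rw [hder]
    exact mul_pos (by positivity) (hpos x)
  · rw [hder, hg]
    have := (aa_pos x).ne'
    field_simp

lemma Tan_all {Γ : Subgroup (Equiv.Perm S1)} (hR : ∀ t, Gc Γ (fun x => x + t)) (ha : Tan Γ aa)
    {u : ℝ → ℝ} (hu : SP u) : Tan Γ u := by
  refine Tan.closed hu fun k ε hε => ?_
  obtain ⟨p, hp, h⟩ := TP_dense k hu ε hε
  refine ⟨p, ?_, ?_⟩
  · clear h
    induction hp using Submodule.span_induction with
    | mem x h => obtain ⟨p, rfl⟩ := h; exact Tan_cz hR ha _ _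
    | zero => exact Tan_zero
    | add x y _ _ h1 h2 => exact h1.add h2
    | smul a x _ h => exact h.cmul a
  · have := h.cmul (hu.sub (TP_SP hp)).sm (-1)
    convert this using 2
    · ring
    · simp
section
variable {u : ℝ → ℝ}

def ww (u : ℝ → ℝ) (t : ℝ) : ℝ → ℝ := fun x => (1 + t * deriv u x)⁻¹

lemma one_add_pos (hpos : ∀ x, 0 < 1 + deriv u x) {t : ℝ} (ht : t ∈ Icc (0 : ℝ) 1) (x : ℝ) :
    0 < 1 + t * deriv u x := by
  have := hpos x
  rcases ht.2.eq_or_lt with h | h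
  · subst h; simpa using this
  · nlinarith [ht.1, mul_nonneg ht.1 this.le]

lemma SP_ww (hu : SP u) (hpos : ∀ x, 0 < 1 + deriv u x) {t : ℝ} (ht : t ∈ Icc (0 : ℝ) 1) :
    SP (ww u t) :=
  ⟨((SP_const 1).add (hu.der.cmul t)).sm.inv fun x => (one_add_pos hpos ht x).ne',
    fun x => by unfold ww; rw [hu.der.per]⟩

lemma ww_bd (hu : SP u) (hpos : ∀ x, 0 < 1 + deriv u x) :
    ∃ B : ℝ, ∀ t ∈ Icc (0 : ℝ) 1, ∀ x, |ww u t x| ≤ B := by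
  obtain ⟨c, hc⟩ := (SP_ww hu hpos (right_mem_Icc.2 zero_le_one)).bdd
  refine ⟨max 1 c, fun t ht x => ?_⟩
  have h1 := one_add_pos hpos ht x
  have h2 := hc x
  have h3 := hpos x
  unfold ww at *
  rw [one_mul, abs_of_pos (inv_pos.2 h3)] at h2
  rw [abs_of_pos (inv_pos.2 h1)]
  have hB : 0 < max 1 c := lt_of_lt_of_le one_pos (le_max_left _ _)
  have h4 : (max 1 c)⁻¹ ≤ 1 + deriv u x :=
    inv_le_of_inv_le₀ h3 (h2.trans (le_max_right _ _))
  have h5 : (max 1 c)⁻¹ ≤ 1 := inv_le_one_of_one_le₀ (le_max_left _ _)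
  apply inv_le_of_inv_le₀ hB
  nlinarith [ht.1, ht.2]

lemma ww_deriv (hu : SP u) (hpos : ∀ x, 0 < 1 + deriv u x) {t : ℝ} (ht : t ∈ Icc (0 : ℝ) 1) :
    deriv (ww u t) = fun x => (-t) * (deriv (deriv u) x * (ww u t x * ww u t x)) := by
  ext x
  have h1 := (one_add_pos hpos ht x).ne'
  have h : HasDerivAt (fun x => 1 + t * deriv u x) (t * deriv (deriv u) x) x :=
    ((hu.der.sm.dif x).hasDerivAt.const_mul t).const_add 1
  have h2 := (h.inv h1).deriv
  have e : (fun x => 1 + t * deriv u x)⁻¹ = ww u t := rfl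
  rw [e] at h2
  rw [h2]
  unfold ww
  field_simp

lemma ww_Nk (hu : SP u) (hpos : ∀ x, 0 < 1 + deriv u x) (k : ℕ) :
    ∃ C : ℝ, ∀ t ∈ Icc (0 : ℝ) 1, Nk k (ww u t) C := by
  obtain ⟨B, hB⟩ := ww_bd hu hpos
  induction k with
  | zero => exact ⟨B, fun t ht => Nk_zero.2 (hB t ht)⟩
  | succ k ih =>
    obtain ⟨C, hC⟩ := ih
    obtain ⟨c, hc0, hc⟩ := hu.der.der.ab' k
    refine ⟨max B (2 ^ k * (c * (2 ^ k * (C * C)))), fun t ht => Nk_succ.2 ⟨fun x =>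
      (hB t ht x).trans (le_max_left _ _), ?_⟩⟩
    have hw := SP_ww hu hpos ht
    have hCt := hC t ht
    rw [ww_deriv hu hpos ht]
    have h1 := (hc.mul hu.der.der.sm (hw.mul hw).sm (hCt.mul hw.sm hw.sm hCt)).cmul
      (hu.der.der.mul (hw.mul hw)).sm (-t)
    refine h1.mono (le_trans ?_ (le_max_right _ _))
    rw [abs_neg, abs_of_nonneg ht.1]
    have := hCt.nonneg
    exact mul_le_of_le_one_left (by positivity) ht.2

lemma sm_hh (hu : SP u) (t : ℝ) : Sm (fun x => x + t * u x) := sm_id.add (hu.cmul t).sm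

lemma F_bd (hu : SP u) (hpos : ∀ x, 0 < 1 + deriv u x) (A : ℝ) (k : ℕ) :
    ∃ D : ℝ, ∀ t ∈ Icc (0 : ℝ) 1, ∀ F : ℝ → ℝ, Sm F → Pk k (fun x => F x + t * u (F x)) A →
      Pk k F D := by
  induction k with
  | zero => exact ⟨0, fun t ht F _ _ => Pk_zero _ _⟩
  | succ k ih =>
    obtain ⟨D, hD⟩ := ih
    obtain ⟨C, hC, H⟩ := Nk_comp k D
    obtain ⟨B, hB⟩ := ww_Nk hu hpos k
    refine ⟨2 ^ k * (A * (C * B)), fun t ht F hF hP => ?_⟩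
    have h1 := hD t ht F hF (hP.down (by omega))
    have h2 := H _ F _ (SP_ww hu hpos ht).sm hF h1 (hB t ht)
    have sE : Sm (fun x => F x + t * u (F x)) := (sm_hh hu t).comp hF
    have h3 := (Pk_succ.1 hP).mul sE.der ((SP_ww hu hpos ht).sm.comp hF) h2
    rw [Pk_succ]
    convert h3 using 1
    ext x
    have e : deriv (fun x => F x + t * u (F x)) x = deriv F x * (1 + t * deriv u (F x)) := by
      have d1 := (hF.dif x).hasDerivAt
      have d2 : HasDerivAt (fun x => u (F x)) (deriv u (F x) * deriv F x) x :=
        (hu.sm.dif (F x)).hasDerivAt.comp x d1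
      have := (d1.add (d2.const_mul t)).deriv
      refine Eq.trans this ?_
      ring
    rw [e]
    have := (one_add_pos hpos ht (F x)).ne'
    show _ = _ * (1 + t * deriv u (F x))⁻¹
    field_simp

lemma Pk_id_add {k : ℕ} {Y : ℝ → ℝ} {c : ℝ} (hY : SP Y) (hc : Nk k Y c) {s : ℝ} (hs : |s| ≤ 1) :
    Pk k (fun x => x + s * Y x) (1 + c) := by
  refine Pk_sub sm_id (sm_id.add (hY.cmul s).sm) (Pk_id k) ?_
  have e : (fun x => x + s * Y x - x) = fun x => s * Y x := by ext x; ring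
  rw [e]
  exact (hc.cmul hY.sm s).mono (mul_le_of_le_one_left hc.nonneg hs)

lemma second_order (k : ℕ) : ∀ {u Y : ℝ → ℝ}, SP u → SP Y → ∃ C : ℝ, 0 ≤ C ∧ ∀ s : ℝ, |s| ≤ 1 →
    Nk k (fun x => u (x + s * Y x) - u x - s * (deriv u x * Y x)) (C * s ^ 2) := by
  have base : ∀ {u Y : ℝ → ℝ}, SP u → SP Y → ∃ C : ℝ, 0 ≤ C ∧ ∀ s x : ℝ,
      |u (x + s * Y x) - u x - s * (deriv u x * Y x)| ≤ C * s ^ 2 := by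
    intro u Y hu hY
    obtain ⟨c, hc0, hc⟩ := hu.der.der.ab' 0
    obtain ⟨d, hd0, hd⟩ := hY.ab' 0
    refine ⟨c * d ^ 2, by positivity, fun s x => ?_⟩
    have h1 := taylor_bd hu.sm hc.bd x (s * Y x)
    have h2 : u (x + s * Y x) - u x - s * (deriv u x * Y x) =
      u (x + s * Y x) - u x - s * Y x * deriv u x := by ring
    rw [h2]
    refine h1.trans ?_
    have h3 : (Y x) ^ 2 ≤ d ^ 2 := sq_le_sq' (by linarith [(abs_le.1 (hd.bd x)).1])
      (abs_le.1 (hd.bd x)).2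
    calc c * (s * Y x) ^ 2 = c * s ^ 2 * (Y x) ^ 2 := by ring
      _ ≤ c * s ^ 2 * d ^ 2 := by gcongr
      _ = _ := by ring
  induction k with
  | zero =>
    intro u Y hu hY
    obtain ⟨C, hC, h⟩ := base hu hY
    exact ⟨C, hC, fun s _ => Nk_zero.2 (h s)⟩
  | succ k ih =>
    intro u Y hu hY
    obtain ⟨C, hC, h⟩ := base hu hY
    obtain ⟨C', hC', h'⟩ := ih hu.der hY
    obtain ⟨c, hc0, hc⟩ := hY.ab' k
    obtain ⟨d, hd0, hd⟩ := hY.der.ab' k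
    obtain ⟨K, hK, H⟩ := Nk_lip k (1 + c) (deriv u) hu.der.sm hu.der.der.ab
    refine ⟨C + (C' + 2 ^ k * ((K * c) * d)), by positivity, fun s hs => Nk_succ.2 ⟨fun x =>
      (h s x).trans ?_, ?_⟩⟩
    · have : 0 ≤ (C' + 2 ^ k * ((K * c) * d)) * s ^ 2 := by positivity
      nlinarith
    · have sF : Sm (fun x => x + s * Y x) := sm_id.add (hY.cmul s).sm
      have e : deriv (fun x => u (x + s * Y x) - u x - s * (deriv u x * Y x)) = fun x =>
          (deriv u (x + s * Y x) - deriv u x - s * (deriv (deriv u) x * Y x)) +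
          s * ((deriv u (x + s * Y x) - deriv u x) * deriv Y x) := by
        ext x
        have d1 : HasDerivAt (fun x => x + s * Y x) (1 + s * deriv Y x) x :=
          (hasDerivAt_id x).add ((hY.sm.dif x).hasDerivAt.const_mul s)
        have d2 : HasDerivAt (fun x => u (x + s * Y x))
            (deriv u (x + s * Y x) * (1 + s * deriv Y x)) x :=
          (hu.sm.dif _).hasDerivAt.comp x d1
        have d3 := ((hu.der.sm.dif x).hasDerivAt.mul (hY.sm.dif x).hasDerivAt).const_mul s
        refine Eq.trans ((d2.sub (hu.sm.dif x).hasDerivAt).sub d3).deriv ?_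
        ring
      rw [e]
      have sU : Sm (fun x => deriv u (x + s * Y x)) := hu.der.sm.comp sF
      have n1 : Nk k (fun x => x + s * Y x - x) (|s| * c) := by
        have e : (fun x => x + s * Y x - x) = fun x => s * Y x := by ext x; ring
        rw [e]; exact hc.cmul hY.sm s
      have a1 := H _ _ _ sF sm_id (Pk_id_add hY hc hs) ((Pk_id k).mono (by linarith)) n1
      have sD : Sm (fun x => deriv u (x + s * Y x) - deriv u x) := sU.sub hu.der.sm
      have a2 := (a1.mul sD hY.der.sm hd).cmul (sD.mul hY.der.sm) s
      have a3 := (h' s hs).add (sD.sub ((hu.der.der.mul hY).cmul s).sm)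
        (contDiff_const.mul (sD.mul hY.der.sm)) a2
      refine a3.mono ?_
      have e5 : |s| * (2 ^ k * (K * (|s| * c) * d)) = 2 ^ k * ((K * c) * d) * s ^ 2 := by
        rw [← sq_abs]; ring
      rw [e5]
      have : 0 ≤ C * s ^ 2 := by positivity
      nlinarith

variable {Γ : Subgroup (Equiv.Perm S1)}

lemma euler_step (hT : ∀ Y, SP Y → Tan Γ Y) (hu : SP u) (hpos : ∀ x, 0 < 1 + deriv u x)
    {t : ℝ} (ht : t ∈ Icc (0 : ℝ) 1) (k : ℕ) (η : ℝ) (hη : 0 < η) :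
    ∃ s₀ : ℝ, 0 < s₀ ∧ ∀ s : ℝ, 0 < s → s < s₀ → ∃ f, Gc Γ f ∧
      Nk k (fun x => f x + (t + s) * u (f x) - (x + t * u x)) (η * s) := by
  set Z : ℝ → ℝ := fun x => (-1) * (u x * ww u t x) with hZ
  have sZ : SP Z := (hu.mul (SP_ww hu hpos ht)).cmul (-1)
  have hZeq : ∀ x, Z x * (1 + t * deriv u x) = - u x := by
    intro x
    have := (one_add_pos hpos ht x).ne'
    rw [hZ]
    unfold ww
    field_simp
  obtain ⟨c, hc0, hc⟩ := sZ.ab' k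
  obtain ⟨C₁, hC₁, H₁⟩ := Nk_lip k (1 + (1 + c)) u hu.sm hu.der.ab
  obtain ⟨C₂, hC₂, H₂⟩ := second_order k hu sZ
  obtain ⟨s₁, hs₁, K⟩ := (hT Z sZ).tan k (min 1 (η / 2 / (1 + C₁))) (by positivity)
  refine ⟨min s₁ (min 1 (η / 2 / (C₂ + C₁ * (1 + c) + 1))), by positivity, fun s hs0 hs => ?_⟩
  rw [lt_min_iff, lt_min_iff] at hs
  obtain ⟨hs1, hs2, hs3⟩ := hs
  have hsa : |s| = s := abs_of_pos hs0
  obtain ⟨f, hf, hN⟩ := K s (by rwa [hsa])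
  rw [hsa] at hN
  set η₁ := min 1 (η / 2 / (1 + C₁)) with hη₁
  have hη1 : η₁ ≤ 1 := min_le_left _ _
  have hη2 : η₁ * (1 + C₁) ≤ η / 2 := by
    rw [← le_div_iff₀ (by positivity)]; exact min_le_right _ _
  have hη0 : 0 < η₁ := by rw [hη₁]; positivity
  refine ⟨f, hf, ?_⟩
  have sf := hf.1.sm
  have sY : Sm (fun x => x + s * Z x) := sm_id.add (sZ.cmul s).sm
  have n1 : Nk k (fun x => f x - x) (s * (1 + c)) := by
    have := hN.add ((sf.sub sm_id).sub (sZ.cmul s).sm) (sZ.cmul s).sm (hc.cmul sZ.sm s)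
    rw [hsa] at this
    have e : (fun x => f x - x - s * Z x + s * Z x) = fun x => f x - x := by ext x; ring
    rw [e] at this
    exact this.mono (by nlinarith)
  have hPf : Pk k f (1 + (1 + c)) :=
    Pk_sub sm_id sf (Pk_id k) (n1.mono (mul_le_of_le_one_left (by positivity) hs2.le))
  have hPY : Pk k (fun x => x + s * Z x) (1 + (1 + c)) :=
    (Pk_id_add sZ hc (by rw [hsa]; exact hs2.le)).mono (by linarith)
  have e0 : (fun x => f x - x - s * Z x) = fun x => f x - (x + s * Z x) := by ext x; ring
  have hN' := hN
  rw [e0] at hN'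
  have uf : Sm (fun x => u (f x)) := hu.sm.comp sf
  have uY : Sm (fun x => u (x + s * Z x)) := hu.sm.comp sY
  have a1 := (H₁ f _ _ sf sY hPf hPY hN').cmul (uf.sub uY) t
  have a2 := (H₂ s (by rw [hsa]; exact hs2.le)).cmul
    ((uY.sub hu.sm).sub ((hu.der.mul sZ).cmul s).sm) t
  have a3 := (H₁ f (fun x => x) _ sf sm_id hPf ((Pk_id k).mono (by linarith)) n1).cmul
    (uf.sub hu.sm) s
  have s0 : Sm (fun x => f x - (x + s * Z x)) := sf.sub sY
  have s1 : Sm (fun x => t * (u (f x) - u (x + s * Z x))) := contDiff_const.mul (uf.sub uY)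
  have s2 : Sm (fun x => t * (u (x + s * Z x) - u x - s * (deriv u x * Z x))) :=
    contDiff_const.mul ((uY.sub hu.sm).sub ((hu.der.mul sZ).cmul s).sm)
  have s3 : Sm (fun x => s * (u (f x) - u x)) := contDiff_const.mul (uf.sub hu.sm)
  have a4 := ((hN'.add s0 s1 a1).add (s0.add s1) s2 a2).add ((s0.add s1).add s2) s3 a3
  have e : (fun x => f x - (x + s * Z x) + t * (u (f x) - u (x + s * Z x)) +
      t * (u (x + s * Z x) - u x - s * (deriv u x * Z x)) + s * (u (f x) - u x)) =
      fun x => f x + (t + s) * u (f x) - (x + t * u x) := by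
    ext x
    linear_combination (-s) * hZeq x
  rw [e] at a4
  refine a4.mono ?_
  rw [hsa, abs_of_nonneg ht.1]
  rw [lt_div_iff₀ (by positivity)] at hs3
  have b1 : t * (C₁ * (η₁ * s)) ≤ C₁ * (η₁ * s) := mul_le_of_le_one_left (by positivity) ht.2
  have b2 : t * (C₂ * s ^ 2) ≤ C₂ * s ^ 2 := mul_le_of_le_one_left (by positivity) ht.2
  have b3 : η₁ * (1 + C₁) * s ≤ η / 2 * s := mul_le_mul_of_nonneg_right hη2 hs0.le
  have b4 : s * (s * (C₂ + C₁ * (1 + c) + 1)) ≤ s * (η / 2) :=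
    mul_le_mul_of_nonneg_left hs3.le hs0.le
  nlinarith [mul_pos hs0 hs0]

lemma euler (hT : ∀ Y, SP Y → Tan Γ Y) (hu : SP u) (hpos : ∀ x, 0 < 1 + deriv u x)
    (k : ℕ) (η : ℝ) (hη : 0 < η) (hη1 : η ≤ 1) :
    ∃ F, Gc Γ F ∧ Nk k (fun x => F x + u (F x) - x) (η + η) := by
  obtain ⟨D, hD⟩ := F_bd hu hpos (1 + 2) k
  obtain ⟨C, hC, H⟩ := Nk_comp k D
  obtain ⟨c, hc0, hc⟩ := hu.ab' k
  set T : Set ℝ := {t | ∀ ε : ℝ, 0 < ε → ∃ F, Gc Γ F ∧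
    Nk k (fun x => F x + t * u (F x) - x) (η * t + ε)} with hTdef
  have bound : ∀ t ∈ Icc (0 : ℝ) 1, ∀ ε : ℝ, ε ≤ 1 → ∀ F, Gc Γ F →
      Nk k (fun x => F x + t * u (F x) - x) (η * t + ε) → Pk k F D := by
    intro t ht ε hε F hF hN
    refine hD t ht F hF.1.sm (Pk_sub sm_id ((sm_hh hu t).comp hF.1.sm) (Pk_id k) (hN.mono ?_))
    nlinarith [ht.1, ht.2]
  have main : Icc (0 : ℝ) 1 ⊆ T := by
    apply IsClosed.Icc_subset_of_forall_exists_gt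
    · refine isClosed_of_closure_subset fun t ht => ?_
      have htI : t ∈ Icc (0 : ℝ) 1 :=
        closure_minimal (inter_subset_right) isClosed_Icc ht
      refine ⟨fun ε hε => ?_, htI⟩
      obtain ⟨t', ⟨ht'T, ht'⟩, hd⟩ := Metric.mem_closure_iff.1 ht (ε / 2 / (C * c + 1))
        (by positivity)
      obtain ⟨F, hF, hN⟩ := ht'T (min (ε / 2) 1) (by positivity)
      have hP := bound t' ht' _ (min_le_right _ _) F hF hN
      refine ⟨F, hF, ?_⟩
      have a1 := H u F c hu.sm hF.1.sm hP hc
      have su : Sm (fun x => u (F x)) := hu.sm.comp hF.1.sm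
      have a2 := hN.add ((hF.1.sm.add (contDiff_const.mul su)).sub sm_id)
        (contDiff_const.mul su) (a1.cmul su (t - t'))
      have e : (fun x => F x + t' * u (F x) - x + (t - t') * u (F x)) =
        fun x => F x + t * u (F x) - x := by ext x; ring
      rw [e] at a2
      refine a2.mono ?_
      rw [Real.dist_eq, lt_div_iff₀ (by positivity)] at hd
      have b1 := min_le_left (ε / 2) 1
      have b2 : η * (t' - t) ≤ |t - t'| := by
        have : t' - t ≤ |t - t'| := by rw [abs_sub_comm]; exact le_abs_self _
        nlinarith [abs_nonneg (t - t')]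
      nlinarith
    · intro ε hε
      exact ⟨_, Gc_id, Nk_of_zero (by simp) (by positivity)⟩
    · rintro t ⟨htT, ht⟩ y hy
      have ht' : t ∈ Icc (0 : ℝ) 1 := ⟨ht.1, ht.2.le⟩
      obtain ⟨s₀, hs₀, K⟩ := euler_step hT hu hpos ht' k (η / C) (by positivity)
      have hy' : 0 < y - t := sub_pos.2 hy
      set s := min (s₀ / 2) (y - t) with hs
      have hs0 : 0 < s := by positivity
      have hs1 : s < s₀ := lt_of_le_of_lt (min_le_left _ _) (by linarith)
      have hs2 : s ≤ y - t := min_le_right _ _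
      refine ⟨t + s, fun ε hε => ?_, by linarith, by linarith⟩
      obtain ⟨f, hf, nf⟩ := K s hs0 hs1
      obtain ⟨F, hF, hN⟩ := htT (min ε 1) (by positivity)
      have hP := bound t ht' _ (min_le_right _ _) F hF hN
      refine ⟨_, hf.comp hF, ?_⟩
      have sr : Sm (fun x => f x + (t + s) * u (f x) - (x + t * u x)) :=
        ((sm_hh hu (t + s)).comp hf.1.sm).sub (sm_hh hu t)
      have a1 := H _ F _ sr hF.1.sm hP nf
      have a2 := hN.add (((sm_hh hu t).comp hF.1.sm).sub sm_id) (sr.comp hF.1.sm) a1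
      have e : (fun x => F x + t * u (F x) - x + (f (F x) + (t + s) * u (f (F x)) -
        (F x + t * u (F x)))) = fun x => f (F x) + (t + s) * u (f (F x)) - x := by ext x; ring
      simp only [Function.comp_apply] at a2
      rw [e] at a2
      refine a2.mono ?_
      have e1 : C * (η / C * s) = η * s := by field_simp
      rw [e1]
      have := min_le_left ε 1
      nlinarith
  obtain ⟨F, hF, hN⟩ := main (right_mem_Icc.2 zero_le_one) η hη
  refine ⟨F, hF, ?_⟩
  simpa using hN

lemma Gc_all (hT : ∀ Y, SP Y → Tan Γ Y) {H : ℝ → ℝ} (hH : Lf H) : Gc Γ H := by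
  obtain ⟨h, hh, r, l⟩ := hH.inv
  have hu : SP (fun x => h x - x) := ⟨hh.sm.sub sm_id, fun x => by rw [hh.per]; ring⟩
  have hpos : ∀ x, 0 < 1 + deriv (fun x => h x - x) x := by
    intro x
    have h1 := ((hh.sm.dif x).hasDerivAt.sub (hasDerivAt_id x)).deriv
    have h2 : deriv (fun x => h x - x) x = deriv h x - 1 := h1
    rw [h2]
    linarith [hh.pos x]
  refine Gc.closed hH fun k ε hε => ?_
  obtain ⟨C, hC, L⟩ := Nk_lip k (1 + 2) H hH.sm hH.der.ab
  obtain ⟨F, hF, hN⟩ := euler hT hu hpos k (min 1 (ε / (2 * (C + 1)))) (by positivity)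
    (min_le_left _ _)
  refine ⟨F, hF, ?_⟩
  have e : (fun x => F x + (h (F x) - F x) - x) = fun x => h (F x) - x := by ext x; ring
  rw [e] at hN
  have m1 := min_le_left 1 (ε / (2 * (C + 1)))
  have m2 := min_le_right 1 (ε / (2 * (C + 1)))
  have sE : Sm (fun x => h (F x)) := hh.sm.comp hF.1.sm
  have hP : Pk k (fun x => h (F x)) (1 + 2) :=
    Pk_sub sm_id sE (Pk_id k) (hN.mono (by linarith))
  have a1 := L _ (fun x => x) _ sE sm_id hP ((Pk_id k).mono (by norm_num)) hN
  simp only [r] at a1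
  refine a1.mono ?_
  rw [le_div_iff₀ (by positivity)] at m2
  have : 0 < min 1 (ε / (2 * (C + 1))) := by positivity
  nlinarith

end

lemma distC_le {k : ℕ} {g h : Equiv.Perm S1} {G H : ℝ → ℝ} {ε : ℝ} (hG : IsLift g G)
    (hH : IsLift h H) (hN : Nk k (fun x => G x - H x) ε) : distC k g h ≤ ε := by
  have h1 : distC k g h ≤ liftDist k G H := by
    refine csInf_le ⟨0, ?_⟩ ⟨G, H, hG, hH, rfl⟩
    rintro d ⟨F, F', _, _, rfl⟩
    exact Real.iSup_nonneg fun j => Real.iSup_nonneg fun x => abs_nonneg _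
  refine h1.trans (ciSup_le fun j => ciSup_le fun x => ?_)
  have := hN j (by have := j.2; omega) x
  rwa [iteratedDeriv_fun_sub (hG.lf.sm.at _ x) (hH.lf.sm.at _ x)] at this

lemma main_aux : ∃ S : Finset (Equiv.Perm S1), (∀ g ∈ S, HasLift g) ∧
      ∀ h : Equiv.Perm S1, HasLift h → ∀ k : ℕ, ∀ ε : ℝ, 0 < ε →
        ∃ g ∈ Subgroup.closure (S : Set (Equiv.Perm S1)), distC k g h < ε := by
  classical
  obtain ⟨ψ, hψ, c, hc, hd⟩ := exists_psi
  obtain ⟨p, hp⟩ := hψ.perm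
  obtain ⟨q, hq⟩ := (Lf_add √2).perm
  refine ⟨{p, q}, ?_, ?_⟩
  · intro g hg
    rcases Finset.mem_insert.1 hg with rfl | hg
    · exact ⟨_, hp⟩
    · rw [Finset.mem_singleton] at hg
      subst hg
      exact ⟨_, hq⟩
  set Γ := Subgroup.closure ((({p, q} : Finset (Equiv.Perm S1)) : Set (Equiv.Perm S1))) with hΓ
  have hpΓ : p ∈ Γ := Subgroup.subset_closure (by simp)
  have hqΓ : q ∈ Γ := Subgroup.subset_closure (by simp)
  have hR : ∀ t, Gc Γ (fun x => x + t) := fun t => Gc_trans hqΓ hq t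
  obtain ⟨χ, hχ, r, l⟩ := hψ.inv
  have h1 : Tan Γ (fun x => deriv χ (ψ x)) :=
    Tan_flow hR (Gc_of_mem hpΓ hp) (Gc_of_mem (Γ.inv_mem hpΓ) (hp.inv hχ r)) l
  have ha : Tan Γ aa := by
    have h2 := h1.cmul (1 / c)
    convert h2 using 1
    ext x
    have h3 : deriv (fun x => χ (ψ x)) x = 1 := by
      have : (fun x => χ (ψ x)) = fun x => x := funext l
      rw [this]; simp
    rw [deriv_comp_fun hχ.sm hψ.sm] at h3
    simp only [hd] at h3
    have := (aa_pos x).ne'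
    field_simp at h3 ⊢
    linarith
  have hT : ∀ Y, SP Y → Tan Γ Y := fun Y hY => Tan_all hR ha hY
  rintro h ⟨H, hH⟩ k ε hε
  obtain ⟨g, hg, G, hG, hN⟩ := (Gc_all hT hH.lf).2 k (ε / 2) (by positivity)
  exact ⟨g, hg, (distC_le hG hH hN).trans_lt (by linarith)⟩

/-- there is a finitely generated subgroup of Diff^∞(ℝ/ℤ) which is dense in
the C^∞ topology. -/
theorem exists_dense_finitely_generated_subgroup :
    ∃ S : Finset (Equiv.Perm S1), (∀ g ∈ S, HasLift g) ∧
      ∀ h : Equiv.Perm S1, HasLift h → ∀ k : ℕ, ∀ ε : ℝ, 0 < ε →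
        ∃ g ∈ Subgroup.closure (S : Set (Equiv.Perm S1)), distC k g h < ε := by
  exact main_aux

end
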